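/- Let r = q/p be a rational number with 0 < r < 1 (gcd(q,p) = 1) and let n ≥ 2 be an integer. Then the even Heckoid group H(r;n) = F/⟨⟨u_r^n⟩⟩ contains no subgroup isomorphic to ℤ × ℤ, and H(r;n) is not virtually abelian, i.e., it contains no abelian subgroup of finite index. -/

import Mathlib

/-- The free group `F = ⟨a, b⟩` on two generators. -/
abbrev F2 := FreeGroup (Fin 2)

/-- the generator `a` of `F`. -/
def ga : F2 := FreeGroup.of 0

/-- the generator `b` of `F`. -/
def gb : F2 := FreeGroup.of 1

/-- `ε_i = (−1)^⌊ i q / p ⌋`, as an integer exponent. -/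
def epsSgn (q p : ℤ) (i : ℕ) : ℤ := (-1) ^ (Int.fdiv ((i : ℤ) * q) p).natAbs

/-- the `i`-th letter (1-indexed): `b` if `i` is odd, `a` if `i` is even. -/
def letterAt (i : ℕ) : F2 := if i % 2 = 1 then gb else ga

/-- the word `w_s = b^{ε₁} a^{ε₂} b^{ε₃} ⋯` (`p − 1` letters), for `s = q/p`. -/
def wWord (q p : ℤ) : F2 :=
  ((List.range (p.toNat - 1)).map (fun i => letterAt (i + 1) ^ epsSgn q p (i + 1))).prod

/-- the word `u_s` representing the simple loop `α_s` of slope `s = q/p`: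
`u_s = a w_s b⁻¹ w_s⁻¹` if `p` is odd and `u_s = a w_s a⁻¹ w_s⁻¹` if `p` is even. -/
def uWord (q p : ℤ) : F2 :=
  if p % 2 = 0 then ga * wWord q p * ga⁻¹ * (wWord q p)⁻¹
  else ga * wWord q p * gb⁻¹ * (wWord q p)⁻¹

/-- `u_s` for a rational number `s`, via its expression in lowest terms. -/
def uRat (s : ℚ) : F2 := uWord s.num (s.den : ℤ)

/-- the normal closure `⟨⟨u_{q/p}^n⟩⟩`, i.e. the relator subgroup of the
even Heckoid group `H(q/p; n) = F/⟨⟨u_{q/p}^n⟩⟩`. -/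
abbrev heckoidRel (q p : ℤ) (n : ℕ) : Subgroup F2 := Subgroup.normalClosure {uWord q p ^ n}

/-- The inverse of a signed letter. -/
def flipLetter {α : Type*} (l : α × Bool) : α × Bool := (l.1, !l.2)

@[simp] theorem flipLetter_flipLetter {α : Type*} (l : α × Bool) :
    flipLetter (flipLetter l) = l := by simp [flipLetter]

@[simp] theorem flipLetter_fst {α : Type*} (l : α × Bool) : (flipLetter l).1 = l.1 := rfl

@[simp] theorem flipLetter_snd {α : Type*} (l : α × Bool) : (flipLetter l).2 = !l.2 := rfl

theorem flipLetter_ne {α : Type*} (l : α × Bool) : flipLetter l ≠ l := by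
  intro h
  have := congrArg Prod.snd h
  simp at this

theorem flipLetter_injective {α : Type*} : Function.Injective (flipLetter (α := α)) :=
  Function.LeftInverse.injective flipLetter_flipLetter

theorem mk_flipLetter {α : Type*} (l : α × Bool) :
    FreeGroup.mk [flipLetter l] = (FreeGroup.mk [l])⁻¹ := by
  simp [flipLetter, FreeGroup.inv_mk, FreeGroup.invRev]

/-- The label of a signed symbol, when symbols are labelled by letters. -/
def signedLabel {S α : Type*} (lab : S → α × Bool) (x : S × Bool) : α × Bool :=
  cond x.2 (lab x.1) (flipLetter (lab x.1))

theorem signedLabel_flipLetter {S α : Type*} (lab : S → α × Bool) (x : S × Bool) :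
    signedLabel lab (flipLetter x) = flipLetter (signedLabel lab x) := by
  rcases x with ⟨s, _ | _⟩ <;> simp [signedLabel, flipLetter]

/-- The value of a signed symbol under an assignment of group elements to symbols. -/
def signedVal {S G : Type*} [Group G] (f : S → G) (x : S × Bool) : G :=
  cond x.2 (f x.1) (f x.1)⁻¹

theorem signedVal_flipLetter {S G : Type*} [Group G] (f : S → G) (x : S × Bool) :
    signedVal f (flipLetter x) = (signedVal f x)⁻¹ := by
  rcases x with ⟨s, _ | _⟩ <;> simp [signedVal, flipLetter]

/-- A nonempty word representing the identity contains two adjacent inverse letters. -/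
theorem exists_adjacent_cancel {α : Type*} (L : List (α × Bool)) (hL : L ≠ [])
    (h : FreeGroup.mk L = 1) : ∃ l₁ x l₂, L = l₁ ++ x :: flipLetter x :: l₂ := by
  classical
  have hred : ¬ FreeGroup.IsReduced L := by
    intro hr
    have h1 := FreeGroup.IsReduced.reduce_eq hr
    have h2 : FreeGroup.reduce L = [] := by
      rw [← FreeGroup.toWord_mk, h, FreeGroup.toWord_one]
    exact hL (h1.symm.trans h2)
  obtain ⟨n, hn, hne⟩ := List.exists_not_getElem_of_not_isChain hred
  push Not at hne
  refine ⟨L.take n, L[n], L.drop (n + 2), ?_⟩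
  have e : flipLetter L[n] = L[n + 1] := by
    apply Prod.ext
    · exact hne.1
    · simp only [flipLetter_snd]
      have := hne.2
      revert this
      cases (L[n]).2 <;> cases (L[n+1]).2 <;> simp
  rw [e]
  conv_lhs => rw [← List.take_append_drop n L]
  rw [List.drop_eq_getElem_cons (by omega), List.drop_eq_getElem_cons (by omega)]

/-- `w` contains each signed symbol at most once; the symbols satisfying `live` occur exactly once,
with positive sign, and any other symbol occurs with both signs or not at all. -/
structure ProperWord {S : Type*} (live : S → Prop) (w : List (S × Bool)) : Prop where
  nodup : w.Nodup
  mem_live : ∀ s, live s → (s, true) ∈ w ∧ (s, false) ∉ w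
  mem_iff : ∀ s, ¬ live s → ((s, true) ∈ w ↔ (s, false) ∈ w)

/-- The free generator, or the inverse of one, carried by a live symbol `s`: the symbols `s` and
`pair s` carry mutually inverse elements. -/
def edgeVal {S T α : Type*} (emb : S → T) (lab : S → α × Bool) (pair : S → S) (s : S) :
    FreeGroup T :=
  cond (lab s).2 (FreeGroup.of (emb s)) (FreeGroup.of (emb (pair s)))⁻¹

/-- A pairing of the live symbols together with a lift of the labels to a free group on the
symbols, in which paired symbols carry inverse generators and the word `w` is still trivial. -/
structure IsUnfolding {S α : Type*} (lab : S → α × Bool) (live : S → Prop) (w : List (S × Bool))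
    (pair : S → S) (val : S → FreeGroup S) : Prop where
  live_pair : ∀ s, live s → live (pair s)
  pair_pair : ∀ s, live s → pair (pair s) = s
  lab_pair : ∀ s, live s → lab (pair s) = flipLetter (lab s)
  val_live : ∀ s, live s → val s = edgeVal id lab pair s
  lift_val : ∀ s, FreeGroup.lift (fun t => FreeGroup.mk [lab t]) (val s) = FreeGroup.mk [lab s]
  prod_eq : (w.map (signedVal val)).prod = 1

theorem prod_map_signedVal_congr {S G : Type*} [Group G] {f g : S → G} {w : List (S × Bool)}
    (h : ∀ x ∈ w, f x.1 = g x.1) :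
    (w.map (signedVal f)).prod = (w.map (signedVal g)).prod := by
  congr 1
  apply List.map_congr_left
  intro x hx
  simp only [signedVal, h x hx]

/-- Replacing the remaining occurrence of an eliminated symbol. -/
def substLetter {S : Type*} [DecidableEq S] (e k z : S × Bool) : S × Bool :=
  if z = flipLetter e then k else z

theorem ne_of_fst_ne {S : Type*} {x y : S × Bool} (h : x.1 ≠ y.1) : x ≠ y := fun e => h (by rw [e])

theorem ProperWord.flipLetter_mem {S : Type*} {live : S → Prop} {w : List (S × Bool)}
    (hw : ProperWord live w) {e : S × Bool} (he : ¬ live e.1) (hmem : e ∈ w) :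
    flipLetter e ∈ w := by
  rcases e with ⟨s, _ | _⟩
  · exact (hw.mem_iff s he).2 hmem
  · exact (hw.mem_iff s he).1 hmem

theorem eq_or_eq_flipLetter {S : Type*} {x y : S × Bool} (h : x.1 = y.1) :
    x = y ∨ x = flipLetter y := by
  rcases x with ⟨x, _ | _⟩ <;> rcases y with ⟨y, _ | _⟩ <;> simp_all [flipLetter]

theorem mem_map_substLetter {S : Type*} [DecidableEq S] {live : S → Prop} {w l : List (S × Bool)}
    {e k : S × Bool} (hw : ProperWord live w) (hmem : ∀ z, z ∈ w ↔ z = e ∨ z = k ∨ z ∈ l)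
    (hnd : (e :: k :: l).Nodup) (hek : e.1 ≠ k.1) (he : ¬ live e.1) (z : S × Bool) :
    z ∈ l.map (substLetter e k) ↔ z ∈ w ∧ z.1 ≠ e.1 := by
  have hfe : flipLetter e ∈ l := by
    have := (hmem _).1 (hw.flipLetter_mem he ((hmem e).2 (Or.inl rfl)))
    rcases this with h | h | h
    · exact absurd h (flipLetter_ne e)
    · exact absurd (congrArg Prod.fst h) hek
    · exact h
  simp only [List.nodup_cons, List.mem_cons, not_or] at hnd
  rw [List.mem_map]
  constructor
  · rintro ⟨y, hy, rfl⟩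
    unfold substLetter
    split_ifs with h
    · exact ⟨(hmem k).2 (Or.inr (Or.inl rfl)), hek.symm⟩
    · refine ⟨(hmem y).2 (Or.inr (Or.inr hy)), fun h1 => ?_⟩
      rcases eq_or_eq_flipLetter h1 with h2 | h2
      · exact hnd.1.2 (h2 ▸ hy)
      · exact h h2
  · rintro ⟨hz, hne⟩
    rcases (hmem z).1 hz with h | h | h
    · exact absurd (congrArg Prod.fst h) hne
    · exact ⟨flipLetter e, hfe, by simp [substLetter, h]⟩
    · refine ⟨z, h, ?_⟩
      rw [substLetter, if_neg (ne_of_fst_ne (y := flipLetter e) hne)]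

theorem ProperWord.map_substLetter {S : Type*} [DecidableEq S] {live : S → Prop}
    {w l : List (S × Bool)} {e k : S × Bool} (hw : ProperWord live w)
    (hmem : ∀ z, z ∈ w ↔ z = e ∨ z = k ∨ z ∈ l)
    (hnd : (e :: k :: l).Nodup) (hek : e.1 ≠ k.1) (he : ¬ live e.1) :
    ProperWord live (l.map (substLetter e k)) := by
  have hm := mem_map_substLetter hw hmem hnd hek he
  simp only [List.nodup_cons, List.mem_cons, not_or] at hnd
  refine ⟨?_, fun s hs => ?_, fun s hs => ?_⟩
  · refine List.Nodup.map_on (fun x hx y hy hxy => ?_) hnd.2.2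
    unfold substLetter at hxy
    split_ifs at hxy with h1 h2 h2
    · exact h1.trans h2.symm
    · exact absurd (hxy ▸ hy) hnd.2.1
    · exact absurd (hxy ▸ hx) hnd.2.1
    · exact hxy
  · have hse : s ≠ e.1 := fun h => he (h ▸ hs)
    rw [hm, hm]
    exact ⟨⟨(hw.mem_live s hs).1, hse⟩, fun h => (hw.mem_live s hs).2 h.1⟩
  · rw [hm, hm, hw.mem_iff s hs]

theorem IsUnfolding.exists_of_substLetter {S α : Type*} [DecidableEq S] {lab : S → α × Bool}
    {live : S → Prop} {w l : List (S × Bool)} {e k : S × Bool} (hw : ProperWord live w)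
    (hmem : ∀ z, z ∈ w ↔ z = e ∨ z = k ∨ z ∈ l)
    (hnd : (e :: k :: l).Nodup) (hek : e.1 ≠ k.1) (he : ¬ live e.1)
    (hlab : signedLabel lab e = flipLetter (signedLabel lab k)) {pair : S → S}
    {val : S → FreeGroup S} (hu : IsUnfolding lab live (l.map (substLetter e k)) pair val) :
    ∃ val' : S → FreeGroup S,
      (∀ s, live s → val' s = edgeVal id lab pair s) ∧
      (∀ s, FreeGroup.lift (fun t => FreeGroup.mk [lab t]) (val' s) = FreeGroup.mk [lab s]) ∧
      (l.map (signedVal val')).prod = 1 ∧ signedVal val' e = (signedVal val' k)⁻¹ := by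
  classical
  have hm := mem_map_substLetter hw hmem hnd hek he
  set v : FreeGroup S := cond e.2 (signedVal val k)⁻¹ (signedVal val k) with hv
  have hk : signedVal (Function.update val e.1 v) k = signedVal val k := by
    simp [signedVal, Function.update_of_ne hek.symm]
  have hee : signedVal (Function.update val e.1 v) e = (signedVal val k)⁻¹ := by
    rcases e with ⟨s, _ | _⟩ <;> simp [signedVal, hv]
  refine ⟨Function.update val e.1 v, fun s hs => ?_, fun s => ?_, ?_, ?_⟩
  · have hse : s ≠ e.1 := fun h => he (h ▸ hs)
    rw [Function.update_of_ne hse]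
    exact hu.val_live s hs
  · by_cases h : s = e.1
    · have hsk : FreeGroup.lift (fun t => FreeGroup.mk [lab t]) (signedVal val k) =
          FreeGroup.mk [signedLabel lab k] := by
        rcases k with ⟨s, _ | _⟩
        · simp only [signedVal, signedLabel, cond_false, map_inv, hu.lift_val, mk_flipLetter]
        · simp only [signedVal, signedLabel, cond_true, hu.lift_val]
      have hk2 : signedLabel lab k = flipLetter (signedLabel lab e) := by rw [hlab]; simp
      subst h
      rw [Function.update_self, hv]
      rcases e with ⟨s, _ | _⟩
      · simp only [cond_false, hsk, hk2]
        simp [signedLabel]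
      · simp only [cond_true, map_inv, hsk, hk2, mk_flipLetter]
        simp [signedLabel]
    · rw [Function.update_of_ne h]
      exact hu.lift_val s
  · rw [← hu.prod_eq, List.map_map]
    congr 1
    apply List.map_congr_left
    intro z hz
    simp only [Function.comp, substLetter]
    split_ifs with h
    · rw [h, signedVal_flipLetter, hee, inv_inv]
    · have : z.1 ≠ e.1 := by
        intro h1
        simp only [List.nodup_cons, List.mem_cons, not_or] at hnd
        rcases eq_or_eq_flipLetter h1 with h2 | h2
        · exact hnd.1.2 (h2 ▸ hz)
        · exact h h2
      simp [signedVal, Function.update_of_ne this]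
  · rw [hee, hk]

theorem exists_isUnfolding {S α : Type*} (lab : S → α × Bool) (n : ℕ) :
    ∀ (live : S → Prop) (w : List (S × Bool)), w.length = n → ProperWord live w →
      FreeGroup.mk (w.map (signedLabel lab)) = 1 →
      ∃ pair val, IsUnfolding lab live w pair val := by
  classical
  induction n using Nat.strong_induction_on with
  | _ n ih =>
  intro live w hlen hw h1
  by_cases hnil : w = []
  · subst hnil
    have hl : ∀ s, ¬ live s := fun s hs => by simpa using (hw.mem_live s hs).1
    refine ⟨id, FreeGroup.of, fun s hs => (hl s hs).elim, fun s hs => (hl s hs).elim,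
      fun s hs => (hl s hs).elim, fun s hs => (hl s hs).elim, fun s => by simp, by simp⟩
  obtain ⟨m₁, a, m₂, hm⟩ := exists_adjacent_cancel (w.map (signedLabel lab)) (by simpa using hnil) h1
  obtain ⟨l₁, l₁', rfl, hl₁, hl₁'⟩ := List.map_eq_append_iff.1 hm
  obtain ⟨x, l₃, rfl, hx, hl₃⟩ := List.map_eq_cons_iff.1 hl₁'
  obtain ⟨y, l₂, rfl, hy, hl₂⟩ := List.map_eq_cons_iff.1 hl₃
  have hlab : signedLabel lab y = flipLetter (signedLabel lab x) := by rw [hx, hy]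
  have hshort : FreeGroup.mk ((l₁ ++ l₂).map (signedLabel lab)) = 1 := by
    rw [← h1, hm, List.map_append, hl₁, hl₂]
    rw [← FreeGroup.mul_mk, ← FreeGroup.mul_mk]
    congr 1
    change _ = FreeGroup.mk ([a] ++ ([flipLetter a] ++ m₂))
    rw [← FreeGroup.mul_mk, ← FreeGroup.mul_mk, mk_flipLetter, mul_inv_cancel_left]
  have hprod : ∀ f : S → FreeGroup S, signedVal f x = (signedVal f y)⁻¹ →
      ((l₁ ++ l₂).map (signedVal f)).prod = 1 →
      ((l₁ ++ x :: y :: l₂).map (signedVal f)).prod = 1 := by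
    intro f hf h
    rw [← h]
    simp [hf]
  have hmem : ∀ z, z ∈ l₁ ++ x :: y :: l₂ ↔ z = x ∨ z = y ∨ z ∈ l₁ ++ l₂ := by
    intro z
    simp only [List.mem_append, List.mem_cons]
    tauto
  have hmem' : ∀ z, z ∈ l₁ ++ x :: y :: l₂ ↔ z = y ∨ z = x ∨ z ∈ l₁ ++ l₂ := by
    intro z
    rw [hmem]
    tauto
  have hperm : (l₁ ++ x :: y :: l₂).Perm (x :: y :: (l₁ ++ l₂)) :=
    List.perm_middle.trans (List.Perm.cons _ List.perm_middle)
  have hnd : (x :: y :: (l₁ ++ l₂)).Nodup := hperm.nodup_iff.1 hw.nodup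
  have hnd' : (y :: x :: (l₁ ++ l₂)).Nodup := (List.Perm.swap x y _).nodup_iff.2 hnd
  have hlen' : (l₁ ++ l₂).length < n := by
    rw [← hlen]
    simp
  by_cases hxy : x.1 = y.1
  · have hyx : x = flipLetter y := by
      rcases eq_or_eq_flipLetter hxy with h | h
      · rw [h] at hlab
        exact absurd hlab.symm (flipLetter_ne _)
      · exact h
    have hnl : ¬ live x.1 := by
      intro hl
      have := (hw.mem_live _ hl).2
      apply this
      rw [hmem]
      rcases y with ⟨s, _ | _⟩ <;> subst hyx <;> simp [flipLetter]
    have hm2 : ∀ z, z ∈ l₁ ++ l₂ ↔ z ∈ l₁ ++ x :: y :: l₂ ∧ z.1 ≠ x.1 := by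
      intro z
      simp only [List.nodup_cons, List.mem_cons, not_or] at hnd
      rw [hmem]
      constructor
      · intro hz
        refine ⟨Or.inr (Or.inr hz), fun h => ?_⟩
        rcases eq_or_eq_flipLetter h with h | h
        · exact hnd.1.2 (h ▸ hz)
        · rw [hyx, flipLetter_flipLetter] at h
          exact hnd.2.1 (h ▸ hz)
      · rintro ⟨h | h | h, hne⟩
        · exact absurd (by rw [h]) hne
        · exact absurd (by rw [h, hxy]) hne
        · exact h
    have hw' : ProperWord live (l₁ ++ l₂) := by
      refine ⟨?_, fun s hs => ?_, fun s hs => ?_⟩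
      · simp only [List.nodup_cons] at hnd
        exact hnd.2.2
      · have hse : s ≠ x.1 := fun h => hnl (h ▸ hs)
        rw [hm2, hm2]
        exact ⟨⟨(hw.mem_live s hs).1, hse⟩, fun h => (hw.mem_live s hs).2 h.1⟩
      · rw [hm2, hm2, hw.mem_iff s hs]
    obtain ⟨pair, val, hu⟩ := ih _ hlen' live _ rfl hw' hshort
    exact ⟨pair, val, hu.live_pair, hu.pair_pair, hu.lab_pair, hu.val_live, hu.lift_val,
      hprod val (by rw [hyx, signedVal_flipLetter]) hu.prod_eq⟩
  have hlen2 : ∀ e k : S × Bool, ((l₁ ++ l₂).map (substLetter e k)).length < n := by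
    intro e k
    simpa using hlen'
  have hshort2 : ∀ e k : S × Bool, signedLabel lab e = flipLetter (signedLabel lab k) →
      FreeGroup.mk (((l₁ ++ l₂).map (substLetter e k)).map (signedLabel lab)) = 1 := by
    intro e k hek
    rw [← hshort, List.map_map]
    congr 1
    apply List.map_congr_left
    intro z _
    simp only [Function.comp, substLetter]
    split_ifs with h
    · rw [h, signedLabel_flipLetter, hek, flipLetter_flipLetter]
    · rfl
  have hlab' : signedLabel lab x = flipLetter (signedLabel lab y) := by rw [hlab]; simp
  by_cases hlx : live x.1
  · by_cases hly : live y.1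
    · have hx2 : x = (x.1, true) := by
        rcases x with ⟨s, _ | _⟩
        · exact absurd ((hmem _).2 (Or.inl rfl)) (hw.mem_live s hlx).2
        · rfl
      have hy2 : y = (y.1, true) := by
        rcases y with ⟨s, _ | _⟩
        · exact absurd ((hmem _).2 (Or.inr (Or.inl rfl))) (hw.mem_live s hly).2
        · rfl
      generalize x.1 = s at *
      generalize y.1 = t at *
      subst hx2 hy2
      simp only [signedLabel, cond_true] at hlab hlab'
      have hxt : ∀ b, (s, b) ∉ l₁ ++ l₂ := by
        intro b hb
        cases b
        · exact (hw.mem_live s hlx).2 ((hmem _).2 (Or.inr (Or.inr hb)))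
        · simp only [List.nodup_cons, List.mem_cons, not_or] at hnd
          exact hnd.1.2 hb
      have hyt : ∀ b, (t, b) ∉ l₁ ++ l₂ := by
        intro b hb
        cases b
        · exact (hw.mem_live t hly).2 ((hmem _).2 (Or.inr (Or.inr hb)))
        · simp only [List.nodup_cons, List.mem_cons, not_or] at hnd
          exact hnd.2.1 hb
      have hm2 : ∀ r, r ≠ s → r ≠ t → ∀ b, ((r, b) ∈ l₁ ++ l₂ ↔
          (r, b) ∈ l₁ ++ (s, true) :: (t, true) :: l₂) := by
        intro r h1 h2 b
        rw [hmem]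
        simp [h1, h2]
      have hw' : ProperWord (fun r => live r ∧ r ≠ s ∧ r ≠ t) (l₁ ++ l₂) := by
        refine ⟨?_, fun r hr => ?_, fun r hr => ?_⟩
        · simp only [List.nodup_cons] at hnd
          exact hnd.2.2
        · rw [hm2 r hr.2.1 hr.2.2, hm2 r hr.2.1 hr.2.2]
          exact hw.mem_live r hr.1
        · by_cases h1 : r = s
          · subst h1; simp [hxt]
          by_cases h2 : r = t
          · subst h2; simp [hyt]
          rw [hm2 r h1 h2, hm2 r h1 h2]
          exact hw.mem_iff r (fun h => hr ⟨h, h1, h2⟩)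
      obtain ⟨pair, val, hu⟩ := ih _ hlen' _ _ rfl hw' hshort
      let pair' : S → S := fun r => if r = s then t else if r = t then s else pair r
      let val' : S → FreeGroup S := fun r =>
        if r = s ∨ r = t then edgeVal id lab pair' r else val r
      have ps : pair' s = t := by simp [pair']
      have pt : pair' t = s := by simp [pair', Ne.symm hxy]
      have pr : ∀ r, r ≠ s → r ≠ t → pair' r = pair r := by
        intro r h1 h2; simp [pair', h1, h2]
      have vs : val' s = edgeVal id lab pair' s := by simp [val']
      have vt : val' t = edgeVal id lab pair' t := by simp [val']
      have vr : ∀ r, r ≠ s → r ≠ t → val' r = val r := by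
        intro r h1 h2; simp [val', h1, h2]
      refine ⟨pair', val', fun r hr => ?_, fun r hr => ?_, fun r hr => ?_, fun r hr => ?_,
        fun r => ?_, ?_⟩
      · by_cases h1 : r = s
        · rw [h1, ps]; exact hly
        by_cases h2 : r = t
        · rw [h2, pt]; exact hlx
        rw [pr r h1 h2]
        exact (hu.live_pair r ⟨hr, h1, h2⟩).1
      · by_cases h1 : r = s
        · rw [h1, ps, pt]
        by_cases h2 : r = t
        · rw [h2, pt, ps]
        have h3 := hu.live_pair r ⟨hr, h1, h2⟩
        rw [pr r h1 h2, pr _ h3.2.1 h3.2.2]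
        exact hu.pair_pair r ⟨hr, h1, h2⟩
      · by_cases h1 : r = s
        · rw [h1, ps, hlab]
        by_cases h2 : r = t
        · rw [h2, pt, hlab']
        rw [pr r h1 h2]
        exact hu.lab_pair r ⟨hr, h1, h2⟩
      · by_cases h1 : r = s
        · rw [h1, vs]
        by_cases h2 : r = t
        · rw [h2, vt]
        rw [vr r h1 h2, hu.val_live r ⟨hr, h1, h2⟩, edgeVal, edgeVal, pr r h1 h2]
      · have key : ∀ r, lab (pair' r) = flipLetter (lab r) →
            FreeGroup.lift (fun t => FreeGroup.mk [lab t]) (edgeVal id lab pair' r) =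
              FreeGroup.mk [lab r] := by
          intro r hr
          unfold edgeVal
          cases hb : (lab r).2
          · simp [hr, mk_flipLetter]
          · simp
        by_cases h1 : r = s
        · rw [h1, vs]; exact key s (by rw [ps, hlab])
        by_cases h2 : r = t
        · rw [h2, vt]; exact key t (by rw [pt, hlab'])
        rw [vr r h1 h2]
        exact hu.lift_val r
      · apply hprod
        · simp only [signedVal, cond_true, vs, vt, edgeVal, ps, pt]
          have : (lab t).2 = !(lab s).2 := by rw [hlab]; rfl
          rw [this]
          cases (lab s).2 <;> simp
        · rw [← hu.prod_eq]
          apply prod_map_signedVal_congr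
          intro z hz
          apply vr
          · rintro h; exact hxt z.2 (by rw [← h]; exact hz)
          · rintro h; exact hyt z.2 (by rw [← h]; exact hz)
    · have hw' := hw.map_substLetter hmem' hnd' (Ne.symm hxy) hly
      obtain ⟨pair, val, hu⟩ := ih _ (hlen2 y x) live _ rfl hw' (hshort2 y x hlab)
      obtain ⟨val', h1, h2, h3, h4⟩ :=
        hu.exists_of_substLetter hw hmem' hnd' (Ne.symm hxy) hly hlab
      exact ⟨pair, val', hu.live_pair, hu.pair_pair, hu.lab_pair, h1, h2,
        hprod val' (by rw [h4, inv_inv]) h3⟩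
  · have hw' := hw.map_substLetter hmem hnd hxy hlx
    obtain ⟨pair, val, hu⟩ := ih _ (hlen2 x y) live _ rfl hw' (hshort2 x y hlab')
    obtain ⟨val', h1, h2, h3, h4⟩ :=
      hu.exists_of_substLetter hw hmem hnd hxy hlx hlab'
    exact ⟨pair, val', hu.live_pair, hu.pair_pair, hu.lab_pair, h1, h2, hprod val' h4 h3⟩

/-- The product of the values along a face with `m` sides, read from the base corner. -/
def faceProd {G : Type*} [Group G] {m : ℕ} (v : ZMod m → G) : G :=
  ((List.range m).map (fun j : ℕ => v (j : ZMod m))).prod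

/-- The product of a commutator with conjugates of face products. -/
def torusProd {G : Type*} [Group G] {N m : ℕ} (X Y : G) (c : Fin N → G)
    (v : Fin N → ZMod m → G) : G :=
  X * Y * X⁻¹ * Y⁻¹ * ((List.finRange N).map (fun i => c i * faceProd (v i) * (c i)⁻¹)).prod

theorem map_faceProd {G H : Type*} [Group G] [Group H] {m : ℕ} (f : G →* H) (v : ZMod m → G) :
    f (faceProd v) = faceProd (fun j => f (v j)) := by
  simp [faceProd, map_list_prod, Function.comp_def]

theorem map_torusProd {G H : Type*} [Group G] [Group H] {N m : ℕ} (f : G →* H) (X Y : G)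
    (c : Fin N → G) (v : Fin N → ZMod m → G) :
    f (torusProd X Y c v) = torusProd (f X) (f Y) (fun i => f (c i)) (fun i j => f (v i j)) := by
  simp [torusProd, map_list_prod, Function.comp_def, map_faceProd]

theorem mk_map_signedLabel {S α : Type*} (lab : S → α × Bool) (w : List (S × Bool)) :
    FreeGroup.mk (w.map (signedLabel lab)) =
      (w.map (signedVal (fun s => FreeGroup.mk [lab s]))).prod := by
  induction w with
  | nil => rfl
  | cons x w ih =>
    rw [List.map_cons, List.map_cons, List.prod_cons, ← ih, ← List.singleton_append,
      ← FreeGroup.mul_mk]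
    congr 1
    rcases x with ⟨s, _ | _⟩
    · simp only [signedLabel, signedVal, cond_false, mk_flipLetter]
    · rfl

section TorusWord

variable {N m : ℕ} {τ : Type*} (len : τ → ℕ)

/-- The positively signed symbols spelling a tail. -/
def tailWord (D : Type*) (t : τ) : List ((((Σ t, Fin (len t)) ⊕ D)) × Bool) :=
  (List.finRange (len t)).map (fun k => (Sum.inl ⟨t, k⟩, true))

/-- The negatively signed symbols spelling the inverse of a tail. -/
def tailWordInv (D : Type*) (t : τ) : List ((((Σ t, Fin (len t)) ⊕ D)) × Bool) :=
  ((List.finRange (len t)).map (fun k => (Sum.inl ⟨t, k⟩, false))).reverse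

theorem mem_tailWord {D : Type*} {t : τ} {z : (((Σ t, Fin (len t)) ⊕ D)) × Bool} :
    z ∈ tailWord len D t ↔ ∃ k, z = (Sum.inl ⟨t, k⟩, true) := by
  simp [tailWord, eq_comm]

theorem mem_tailWordInv {D : Type*} {t : τ} {z : (((Σ t, Fin (len t)) ⊕ D)) × Bool} :
    z ∈ tailWordInv len D t ↔ ∃ k, z = (Sum.inl ⟨t, k⟩, false) := by
  simp [tailWordInv, eq_comm]

theorem nodup_tailWord (D : Type*) (t : τ) : (tailWord len D t).Nodup := by
  refine List.Nodup.map (fun a b h => ?_) (List.nodup_finRange _)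
  simpa using h

theorem nodup_tailWordInv (D : Type*) (t : τ) : (tailWordInv len D t).Nodup := by
  refine List.nodup_reverse.2 (List.Nodup.map (fun a b h => ?_) (List.nodup_finRange _))
  simpa using h

theorem prod_tailWordInv {D G : Type*} [Group G] (t : τ) (f : (Σ t, Fin (len t)) ⊕ D → G) :
    ((tailWordInv len D t).map (signedVal f)).prod =
      ((tailWord len D t).map (signedVal f)).prod⁻¹ := by
  rw [List.prod_inv_reverse, tailWordInv, List.map_reverse, tailWord, List.map_map, List.map_map,
    List.map_map]
  rfl

/-- The sides of the face `i`. -/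
def faceWord {T : Type*} {ι : Type*} (m : ℕ) (i : ι) : List ((T ⊕ (ι × ZMod m)) × Bool) :=
  (List.range m).map (fun j : ℕ => (Sum.inr (i, (j : ZMod m)), true))

theorem mem_faceWord [NeZero m] {T ι : Type*} {i : ι} {z : (T ⊕ (ι × ZMod m)) × Bool} :
    z ∈ faceWord m i ↔ ∃ j, z = (Sum.inr (i, j), true) := by
  rw [faceWord, List.mem_map]
  constructor
  · rintro ⟨j, _, rfl⟩
    exact ⟨_, rfl⟩
  · rintro ⟨j, rfl⟩
    exact ⟨j.val, List.mem_range.2 (ZMod.val_lt j), by rw [ZMod.natCast_zmod_val]⟩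

theorem nodup_faceWord {T ι : Type*} (i : ι) : (faceWord (T := T) m i).Nodup := by
  refine List.Nodup.map_on (fun a ha b hb h => ?_) List.nodup_range
  rw [List.mem_range] at ha hb
  simp only [Prod.mk.injEq, Sum.inr.injEq, true_and, and_true] at h
  exact CharP.natCast_injOn_Iio (ZMod m) m ha hb h

/-- The word in tail and face symbols spelling a `torusProd`. -/
def torusWord {N : ℕ} (m : ℕ) (len : Fin N ⊕ Bool → ℕ) :
    List (((Σ t, Fin (len t)) ⊕ (Fin N × ZMod m)) × Bool) :=
  tailWord len _ (Sum.inr true) ++ tailWord len _ (Sum.inr false) ++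
    tailWordInv len _ (Sum.inr true) ++ tailWordInv len _ (Sum.inr false) ++
    (List.finRange N).flatMap (fun i =>
      tailWord len _ (Sum.inl i) ++ faceWord m i ++ tailWordInv len _ (Sum.inl i))

theorem prod_torusWord {G : Type*} [Group G] (len : Fin N ⊕ Bool → ℕ)
    (f : (Σ t, Fin (len t)) ⊕ (Fin N × ZMod m) → G) :
    ((torusWord m len).map (signedVal f)).prod =
      torusProd ((tailWord len _ (Sum.inr true)).map (signedVal f)).prod
        ((tailWord len _ (Sum.inr false)).map (signedVal f)).prod
        (fun i => ((tailWord len _ (Sum.inl i)).map (signedVal f)).prod)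
        (fun i j => f (Sum.inr (i, j))) := by
  simp only [torusWord, torusProd, List.map_append, List.prod_append, prod_tailWordInv]
  congr 1
  rw [List.map_flatMap, List.flatMap_def, List.prod_flatten, List.map_map]
  congr 1
  apply List.map_congr_left
  intro i _
  simp only [Function.comp, List.map_append, List.prod_append, prod_tailWordInv, faceProd, faceWord,
    List.map_map]
  rfl

theorem mem_torusWord [NeZero m] {len : Fin N ⊕ Bool → ℕ}
    {z : ((Σ t, Fin (len t)) ⊕ (Fin N × ZMod m)) × Bool} :
    z ∈ torusWord m len ↔ (∃ s b, z = (Sum.inl s, b)) ∨ ∃ d, z = (Sum.inr d, true) := by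
  simp only [torusWord, List.mem_append, List.mem_flatMap, mem_tailWord, mem_tailWordInv,
    mem_faceWord, List.mem_finRange, true_and]
  constructor
  · rintro ((((⟨k, rfl⟩ | ⟨k, rfl⟩) | ⟨k, rfl⟩) | ⟨k, rfl⟩) | ⟨i, (⟨k, rfl⟩ | ⟨k, rfl⟩) | ⟨k, rfl⟩⟩) <;>
      simp
  · rintro (⟨⟨i | _ | _, k⟩, _ | _, rfl⟩ | ⟨⟨i, j⟩, rfl⟩) <;> simp

theorem nodup_torusWord [NeZero m] (len : Fin N ⊕ Bool → ℕ) : (torusWord m len).Nodup := by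
  simp only [torusWord, List.nodup_append, List.nodup_flatMap, nodup_tailWord, nodup_tailWordInv,
    nodup_faceWord, mem_tailWord, mem_tailWordInv, mem_faceWord, List.mem_append, List.mem_flatMap,
    true_and]
  refine ⟨⟨⟨?_, ?_⟩, ?_⟩, ⟨?_, ?_⟩, ?_⟩
  · rintro _ ⟨k, rfl⟩ _ ⟨l, rfl⟩
    simp
  · rintro _ (⟨k, rfl⟩ | ⟨k, rfl⟩) _ ⟨l, rfl⟩ <;> simp
  · rintro _ ((⟨k, rfl⟩ | ⟨k, rfl⟩) | ⟨k, rfl⟩) _ ⟨l, rfl⟩ <;> simp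
  · refine fun i _ => ⟨?_, ?_⟩
    · rintro _ ⟨k, rfl⟩ _ ⟨l, rfl⟩
      simp
    · rintro _ (⟨k, rfl⟩ | ⟨k, rfl⟩) _ ⟨l, rfl⟩ <;> simp
  · refine List.Pairwise.imp (fun {i j} hij => ?_) (List.nodup_finRange N)
    intro z h1 h2
    simp only [List.mem_append, mem_tailWord, mem_tailWordInv, mem_faceWord] at h1 h2
    rcases h1 with (⟨k, rfl⟩ | ⟨k, rfl⟩) | ⟨k, rfl⟩ <;>
      rcases h2 with (⟨l, h⟩ | ⟨l, h⟩) | ⟨l, h⟩ <;> simp [hij] at h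
  · rintro _ (((⟨k, rfl⟩ | ⟨k, rfl⟩) | ⟨k, rfl⟩) | ⟨k, rfl⟩) _
      ⟨i, _, (⟨l, rfl⟩ | ⟨l, rfl⟩) | ⟨l, rfl⟩⟩ <;> simp

end TorusWord

/-- If a commutator times a product of conjugates of face words is trivial in a free group, the
sides of the faces can be paired off so that the relation lifts to a free group with one generator
for each pair. -/
theorem exists_torus_unfolding {α : Type*} {N m : ℕ} [NeZero m] (X Y : FreeGroup α)
    (c : Fin N → FreeGroup α) (r : Fin N → ZMod m → α × Bool)
    (h : torusProd X Y c (fun i j => FreeGroup.mk [r i j]) = 1) :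
    ∃ (S : Type) (emb : Fin N × ZMod m → S) (lab : S → α × Bool)
      (ι : Fin N × ZMod m → Fin N × ZMod m) (X' Y' : FreeGroup S) (c' : Fin N → FreeGroup S),
      Function.Injective emb ∧ (∀ d, lab (emb d) = r d.1 d.2) ∧ (∀ d, ι (ι d) = d) ∧
      (∀ d, r (ι d).1 (ι d).2 = flipLetter (r d.1 d.2)) ∧
      FreeGroup.lift (fun t => FreeGroup.mk [lab t]) X' = X ∧
      FreeGroup.lift (fun t => FreeGroup.mk [lab t]) Y' = Y ∧
      (∀ i, FreeGroup.lift (fun t => FreeGroup.mk [lab t]) (c' i) = c i) ∧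
      torusProd X' Y' c' (fun i j => cond (r i j).2 (FreeGroup.of (emb (i, j)))
        (FreeGroup.of (emb (ι (i, j))))⁻¹) = 1 := by
  classical
  let g : Fin N ⊕ Bool → FreeGroup α := Sum.elim c (fun b => cond b X Y)
  let len : Fin N ⊕ Bool → ℕ := fun t => (g t).toWord.length
  let S := (Σ t, Fin (len t)) ⊕ (Fin N × ZMod m)
  let lab : S → α × Bool := Sum.elim (fun s => (g s.1).toWord.get s.2) (fun d => r d.1 d.2)
  have htail : ∀ t, ((tailWord len (Fin N × ZMod m) t).map
      (signedVal (fun s => FreeGroup.mk [lab s]))).prod = g t := by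
    intro t
    rw [← mk_map_signedLabel, tailWord, List.map_map]
    have : (signedLabel lab ∘ fun k : Fin (len t) =>
        ((Sum.inl ⟨t, k⟩, true) : S × Bool)) = (g t).toWord.get := rfl
    rw [this, List.map_get_finRange, FreeGroup.mk_toWord]
  have hmem : ∀ z : S × Bool, z ∈ torusWord m len ↔
      (∃ s b, z = (Sum.inl s, b)) ∨ ∃ d, z = (Sum.inr d, true) := fun z => mem_torusWord
  have hproper : ProperWord (fun s : S => ∃ d, s = Sum.inr d) (torusWord m len) := by
    refine ⟨nodup_torusWord len, ?_, ?_⟩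
    · rintro _ ⟨d, rfl⟩
      simp [hmem]
    · rintro (s | d) hs
      · simp [hmem]
      · exact (hs ⟨d, rfl⟩).elim
  have hone : FreeGroup.mk ((torusWord m len).map (signedLabel lab)) = 1 := by
    rw [mk_map_signedLabel, prod_torusWord, htail, htail]
    simp only [htail]
    exact h
  obtain ⟨pair, val, hu⟩ := exists_isUnfolding lab _ _ _ rfl hproper hone
  have hpair : ∀ d, ∃ d', pair (Sum.inr d) = Sum.inr d' := fun d => hu.live_pair _ ⟨d, rfl⟩
  choose ι hι using hpair
  have htail' : ∀ t, FreeGroup.lift (fun t => FreeGroup.mk [lab t])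
      ((tailWord len (Fin N × ZMod m) t).map (signedVal val)).prod = g t := by
    intro t
    rw [← htail t, map_list_prod, List.map_map]
    congr 1
    apply List.map_congr_left
    rintro ⟨s, _ | _⟩ _ <;> simp [signedVal, hu.lift_val]
  refine ⟨S, Sum.inr, lab, ι, _, _, _, Sum.inr_injective, fun d => rfl, fun d => ?_, fun d => ?_,
    htail' (Sum.inr true), htail' (Sum.inr false), fun i => htail' (Sum.inl i), ?_⟩
  · have := hu.pair_pair (Sum.inr d) ⟨d, rfl⟩
    rw [hι, hι] at this
    exact Sum.inr_injective this
  · have := hu.lab_pair (Sum.inr d) ⟨d, rfl⟩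
    rw [hι] at this
    exact this
  · have := hu.prod_eq
    rw [prod_torusWord] at this
    rw [← this]
    congr 1
    funext i j
    rw [hu.val_live _ ⟨(i, j), rfl⟩, edgeVal, hι]
    rfl

/-- The Heisenberg group over `ℚ`. -/
@[ext]
structure Heis where
  /-- the first abelian coordinate -/
  a : ℚ
  /-- the second abelian coordinate -/
  b : ℚ
  /-- the central coordinate -/
  c : ℚ

namespace Heis

instance : Mul Heis := ⟨fun x y => ⟨x.a + y.a, x.b + y.b, x.c + y.c + x.a * y.b⟩⟩
instance : One Heis := ⟨⟨0, 0, 0⟩⟩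
instance : Inv Heis := ⟨fun x => ⟨-x.a, -x.b, -x.c + x.a * x.b⟩⟩

@[simp] theorem mul_a (x y : Heis) : (x * y).a = x.a + y.a := rfl
@[simp] theorem mul_b (x y : Heis) : (x * y).b = x.b + y.b := rfl
@[simp] theorem mul_c (x y : Heis) : (x * y).c = x.c + y.c + x.a * y.b := rfl
@[simp] theorem one_a : (1 : Heis).a = 0 := rfl
@[simp] theorem one_b : (1 : Heis).b = 0 := rfl
@[simp] theorem one_c : (1 : Heis).c = 0 := rfl
@[simp] theorem inv_a (x : Heis) : x⁻¹.a = -x.a := rfl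
@[simp] theorem inv_b (x : Heis) : x⁻¹.b = -x.b := rfl
@[simp] theorem inv_c (x : Heis) : x⁻¹.c = -x.c + x.a * x.b := rfl

instance : Group Heis := Group.ofLeftAxioms
  (fun x y z => by ext <;> simp <;> ring)
  (fun x => by ext <;> simp)
  (fun x => by ext <;> simp)

theorem prod_range (w : ℕ → Heis) (n : ℕ) :
    (((List.range n).map w).prod).a = ∑ j ∈ Finset.range n, (w j).a ∧
    (((List.range n).map w).prod).b = ∑ j ∈ Finset.range n, (w j).b ∧
    (((List.range n).map w).prod).c =
      ∑ j ∈ Finset.range n, ((w j).c + (∑ t ∈ Finset.range j, (w t).a) * (w j).b) := by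
  induction n with
  | zero => simp
  | succ n ih =>
    simp only [List.range_succ, List.map_append, List.map_cons, List.map_nil, List.prod_append,
      List.prod_cons, List.prod_nil, mul_one, mul_a, mul_b, mul_c, ih, Finset.sum_range_succ]
    refine ⟨trivial, trivial, by ring⟩

theorem prod_c_of_a_eq_zero (l : List Heis) (h : ∀ x ∈ l, x.a = 0) :
    l.prod.a = 0 ∧ l.prod.c = (l.map Heis.c).sum := by
  induction l with
  | nil => simp
  | cons x l ih =>
    have h1 := h x (by simp)
    have h2 := ih (fun y hy => h y (by simp [hy]))
    simp [h1, h2]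

theorem torusProd_c {N m : ℕ} (X Y : Heis) (c : Fin N → Heis) (v : Fin N → ZMod m → Heis)
    (hX : X.a = 0) (hY : Y.a = 0)
    (hv : ∀ i, ∑ j ∈ Finset.range m, (v i (j : ZMod m)).a = 0) :
    (torusProd X Y c v).c = ∑ i, ∑ j ∈ Finset.range m, ((v i (j : ZMod m)).c +
      ((c i).a + ∑ t ∈ Finset.range j, (v i (t : ZMod m)).a) * (v i (j : ZMod m)).b) := by
  have hf : ∀ i, (faceProd (v i)).a = 0 := fun i => by rw [faceProd, (prod_range _ m).1, hv]
  have h1 := prod_c_of_a_eq_zero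
    ((List.finRange N).map (fun i => c i * faceProd (v i) * (c i)⁻¹)) (by simp [hf])
  rw [torusProd, mul_c, h1.2, List.map_map, ← Fin.sum_univ_def]
  have h2 : ∀ i, (Heis.c ∘ fun i => c i * faceProd (v i) * (c i)⁻¹) i =
      ∑ j ∈ Finset.range m, ((v i (j : ZMod m)).c +
      ((c i).a + ∑ t ∈ Finset.range j, (v i (t : ZMod m)).a) * (v i (j : ZMod m)).b) := by
    intro i
    have e := prod_range (fun j : ℕ => v i (j : ZMod m)) m
    have h3 : (c i * faceProd (v i) * (c i)⁻¹).c =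
        (faceProd (v i)).c + (c i).a * (faceProd (v i)).b := by
      simp [hf]
      ring
    simp only [Function.comp, h3]
    rw [faceProd, e.2.2, e.2.1, Finset.mul_sum, ← Finset.sum_add_distrib]
    apply Finset.sum_congr rfl
    intro j _
    ring
  simp only [h2, mul_a, mul_c, inv_a, inv_b, inv_c, hX, hY]
  ring

end Heis

theorem ZMod.sum_range_natCast {M : Type*} [AddCommMonoid M] {m : ℕ} [NeZero m] (F : ZMod m → M) :
    ∑ j ∈ Finset.range m, F (j : ZMod m) = ∑ j, F j := by
  refine Finset.sum_bij' (fun j _ => (j : ZMod m)) (fun j _ => j.val) ?_ ?_ ?_ ?_ ?_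
  · simp
  · intro j _
    exact Finset.mem_range.2 (ZMod.val_lt j)
  · intro j hj
    exact ZMod.val_cast_of_lt (Finset.mem_range.1 hj)
  · simp
  · simp

/-- The weighted exponent sum of an element of a free group, as a linear function of the weights. -/
def expSum {S : Type*} (g : FreeGroup S) : (S → ℚ) →ₗ[ℚ] ℚ where
  toFun h := (FreeGroup.lift (fun s => Multiplicative.ofAdd (h s)) g).toAdd
  map_add' h k := by
    induction g using FreeGroup.induction_on with
    | C1 => simp
    | of s => simp
    | inv_of s _ => simp; ring
    | mul x y hx hy => simp only [map_mul, toAdd_mul, hx, hy]; ring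
  map_smul' q h := by
    induction g using FreeGroup.induction_on with
    | C1 => simp
    | of s => simp
    | inv_of s _ => simp
    | mul x y hx hy => simp only [map_mul, toAdd_mul, hx, hy, smul_add]

/-- The map to the Heisenberg group with the given abelian coordinates. -/
def heisHom {S : Type*} (h k : S → ℚ) : FreeGroup S →* Heis := FreeGroup.lift fun s => ⟨h s, k s, 0⟩

theorem heisHom_a {S : Type*} (h k : S → ℚ) (g : FreeGroup S) : (heisHom h k g).a = expSum g h := by
  induction g using FreeGroup.induction_on with
  | C1 => simp [expSum]
  | of s => simp [expSum, heisHom]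
  | inv_of s _ => simp [expSum, heisHom]
  | mul x y hx hy =>
    rw [map_mul, Heis.mul_a, hx, hy]
    simp [expSum]

section Potential

variable {S : Type*} {N m : ℕ}

/-- The next side of the same face. -/
def nextSide (N m : ℕ) : Equiv.Perm (Fin N × ZMod m) :=
  (Equiv.refl _).prodCongr (Equiv.addRight 1)

@[simp] theorem nextSide_apply (d : Fin N × ZMod m) : nextSide N m d = (d.1, d.2 + 1) := rfl

/-- The weight of a side. -/
def sideWeight (emb : Fin N × ZMod m → S) (ι : Fin N × ZMod m → Fin N × ZMod m)
    (sgn : Fin N × ZMod m → Bool) (d : Fin N × ZMod m) : (S → ℚ) →ₗ[ℚ] ℚ :=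
  cond (sgn d) (LinearMap.proj (emb d)) (-LinearMap.proj (emb (ι d)))

/-- The potential at the initial corner of a side. -/
def potential (emb : Fin N × ZMod m → S) (ι : Fin N × ZMod m → Fin N × ZMod m)
    (sgn : Fin N × ZMod m → Bool) (c : Fin N → FreeGroup S) (d : Fin N × ZMod m) :
    (S → ℚ) →ₗ[ℚ] ℚ :=
  expSum (c d.1) + ∑ t ∈ Finset.range d.2.val, sideWeight emb ι sgn (d.1, (t : ZMod m))

variable {emb : Fin N × ZMod m → S} {ι : Fin N × ZMod m → Fin N × ZMod m}
  {sgn : Fin N × ZMod m → Bool}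

theorem sideWeight_pair (hι : ∀ d, ι (ι d) = d) (hsgn : ∀ d, sgn (ι d) = !sgn d)
    (d : Fin N × ZMod m) : sideWeight emb ι sgn (ι d) = -sideWeight emb ι sgn d := by
  unfold sideWeight
  rw [hsgn, hι]
  cases sgn d <;> simp

theorem potential_nextSide [NeZero m] (c : Fin N → FreeGroup S) (h : S → ℚ)
    (hface : ∀ i, ∑ j : ZMod m, sideWeight emb ι sgn (i, j) h = 0) (d : Fin N × ZMod m) :
    potential emb ι sgn c (nextSide N m d) h =
      potential emb ι sgn c d h + sideWeight emb ι sgn d h := by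
  obtain ⟨i, j⟩ := d
  have h1 : ∑ t ∈ Finset.range (j.val + 1), sideWeight emb ι sgn (i, (t : ZMod m)) h =
      ∑ t ∈ Finset.range j.val, sideWeight emb ι sgn (i, (t : ZMod m)) h +
        sideWeight emb ι sgn (i, j) h := by
    rw [Finset.sum_range_succ, ZMod.natCast_zmod_val]
  simp only [potential, nextSide_apply, LinearMap.add_apply, LinearMap.sum_apply, add_assoc, ← h1]
  congr 1
  rcases Nat.lt_or_ge (j.val + 1) m with hj | hj
  · have h2 : j + 1 = ((j.val + 1 : ℕ) : ZMod m) := by simp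
    rw [h2, ZMod.val_cast_of_lt hj]
  · have hj' : j.val + 1 = m := le_antisymm (ZMod.val_lt j) hj
    have h0 : j + 1 = 0 := by
      have := congrArg (Nat.cast : ℕ → ZMod m) hj'
      simpa using this
    rw [h0, hj', ZMod.sum_range_natCast (fun t => sideWeight emb ι sgn (i, t) h), hface]
    simp

theorem potential_pair [NeZero m] (hemb : Function.Injective emb) (hι : ∀ d, ι (ι d) = d)
    (hsgn : ∀ d, sgn (ι d) = !sgn d) {X Y : FreeGroup S} {c : Fin N → FreeGroup S}
    (heq : torusProd X Y c (fun i j => cond (sgn (i, j)) (FreeGroup.of (emb (i, j)))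
        (FreeGroup.of (emb (ι (i, j))))⁻¹) = 1) (h : S → ℚ)
    (hX : expSum X h = 0) (hY : expSum Y h = 0)
    (hface : ∀ i, ∑ j : ZMod m, sideWeight emb ι sgn (i, j) h = 0) (d : Fin N × ZMod m) :
    potential emb ι sgn c (nextSide N m (ι d)) h = potential emb ι sgn c d h := by
  classical
  suffices hpos : ∀ d, sgn d = true →
      potential emb ι sgn c (nextSide N m (ι d)) h = potential emb ι sgn c d h by
    cases hd : sgn d
    · have h1 := hpos (ι d) (by rw [hsgn, hd]; rfl)
      rw [hι, potential_nextSide c h hface] at h1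
      rw [potential_nextSide c h hface, ← h1, sideWeight_pair hι hsgn]
      simp
    · exact hpos d hd
  intro d₀ hd₀
  set k : S → ℚ := Pi.single (emb d₀) 1 with hk
  have key := congrArg (fun g => (heisHom h k g).c) heq
  simp only [map_one, Heis.one_c, map_torusProd] at key
  set v : Fin N → ZMod m → Heis := fun i j => heisHom h k (cond (sgn (i, j))
    (FreeGroup.of (emb (i, j))) (FreeGroup.of (emb (ι (i, j))))⁻¹) with hv
  have hva : ∀ i j, (v i j).a = sideWeight emb ι sgn (i, j) h := by
    intro i j
    simp only [hv, sideWeight]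
    cases sgn (i, j) <;> simp [heisHom]
  rw [Heis.torusProd_c _ _ _ _ (by rw [heisHom_a, hX]) (by rw [heisHom_a, hY])] at key
  swap
  · intro i
    simp only [hva]
    rw [ZMod.sum_range_natCast (fun t => sideWeight emb ι sgn (i, t) h), hface]
  have hterm : ∀ i, ∀ j ∈ Finset.range m, ((v i (j : ZMod m)).c +
      ((heisHom h k (c i)).a + ∑ t ∈ Finset.range j, (v i (t : ZMod m)).a) *
        (v i (j : ZMod m)).b) =
      (fun j' : ZMod m => (if (i, j') = d₀ then potential emb ι sgn c (i, j') h else 0) -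
        (if (i, j') = ι d₀ then potential emb ι sgn c (nextSide N m (i, j')) h else 0)) j := by
    intro i j hj
    have hP : (heisHom h k (c i)).a + ∑ t ∈ Finset.range j, (v i (t : ZMod m)).a =
        potential emb ι sgn c (i, (j : ZMod m)) h := by
      simp only [potential, LinearMap.add_apply, LinearMap.sum_apply, heisHom_a, hva]
      rw [ZMod.val_cast_of_lt (Finset.mem_range.1 hj)]
    rw [hP]
    generalize (j : ZMod m) = j
    simp only [potential_nextSide c h hface]
    have hs : ∀ d, sgn d = false → d ≠ d₀ := by
      rintro d hd rfl
      simp [hd] at hd₀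
    have hs' : ∀ d, sgn d = true → d ≠ ι d₀ := by
      rintro d hd rfl
      simp [hsgn, hd₀] at hd
    cases hb : sgn (i, j)
    · rw [if_neg (hs _ hb)]
      have e1 : (v i j).b = -k (emb (ι (i, j))) := by simp [hv, hb, heisHom]
      have e2 : (v i j).c = h (emb (ι (i, j))) * k (emb (ι (i, j))) := by simp [hv, hb, heisHom]
      have e3 : sideWeight emb ι sgn (i, j) h = -h (emb (ι (i, j))) := by simp [sideWeight, hb]
      rw [e1, e2, e3]
      by_cases hd : (i, j) = ι d₀
      · have : k (emb (ι (i, j))) = 1 := by rw [hd, hι, hk, Pi.single_eq_same]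
        rw [if_pos hd, this]
        ring
      · have : k (emb (ι (i, j))) = 0 := by
          rw [hk, Pi.single_eq_of_ne]
          intro h1
          exact hd (by rw [← hemb h1, hι])
        rw [if_neg hd, this]
        ring
    · rw [if_neg (hs' _ hb)]
      have e1 : (v i j).b = k (emb (i, j)) := by simp [hv, hb, heisHom]
      have e2 : (v i j).c = 0 := by simp [hv, hb, heisHom]
      rw [e1, e2]
      by_cases hd : (i, j) = d₀
      · have : k (emb (i, j)) = 1 := by rw [hd, hk, Pi.single_eq_same]
        rw [if_pos hd, this]
        ring
      · have : k (emb (i, j)) = 0 := by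
          rw [hk, Pi.single_eq_of_ne]
          intro h1
          exact hd (hemb h1)
        rw [if_neg hd, this]
        ring
  rw [Finset.sum_congr rfl (fun i _ => Finset.sum_congr rfl (hterm i))] at key
  rw [Finset.sum_congr rfl (fun i _ => ZMod.sum_range_natCast (fun j' : ZMod m =>
    (if (i, j') = d₀ then potential emb ι sgn c (i, j') h else 0) -
      (if (i, j') = ι d₀ then potential emb ι sgn c (nextSide N m (i, j')) h else 0))),
    ← Finset.univ.sum_product' Finset.univ (fun i j' =>
    (if (i, j') = d₀ then potential emb ι sgn c (i, j') h else 0) -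
      (if (i, j') = ι d₀ then potential emb ι sgn c (nextSide N m (i, j')) h else 0))] at key
  simp only [Prod.mk.eta, Finset.sum_sub_distrib, Finset.univ_product_univ, Finset.sum_ite_eq',
    Finset.mem_univ, if_true] at key
  linarith

end Potential

/-- The corners of the complex obtained by gluing paired sides: the relation identifies the
initial corners of the sides around a common vertex. -/
abbrev GluedVertex {N m : ℕ} (ι : Fin N × ZMod m → Fin N × ZMod m) : Type :=
  Quot (fun d e => nextSide N m (ι d) = e)

theorem two_mul_card_pos {D : Type*} [Fintype D] {ι : D → D} {sgn : D → Bool}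
    (hι : ∀ d, ι (ι d) = d) (hsgn : ∀ d, sgn (ι d) = !sgn d) :
    2 * Fintype.card {d // sgn d = true} = Fintype.card D := by
  classical
  have e : Fintype.card {d // sgn d = true} = Fintype.card {d // ¬ sgn d = true} :=
    Fintype.card_congr
      ⟨fun d => ⟨ι d.1, by simp [hsgn, d.2]⟩, fun d => ⟨ι d.1, by simpa [hsgn] using d.2⟩,
        fun d => by simp [hι], fun d => by simp [hι]⟩
  have := Fintype.card_subtype_compl (fun d => sgn d = true)
  have h2 := Fintype.card_subtype_le (fun d => sgn d = true)
  omega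

/-- The gluing of a torus from `N` faces has at least `E - N` vertices. -/
theorem card_gluedVertex_ge {S : Type*} {N m : ℕ} [NeZero m] (hN : 0 < N)
    {emb : Fin N × ZMod m → S} {ι : Fin N × ZMod m → Fin N × ZMod m}
    {sgn : Fin N × ZMod m → Bool} (hemb : Function.Injective emb) (hι : ∀ d, ι (ι d) = d)
    (hsgn : ∀ d, sgn (ι d) = !sgn d) {X Y : FreeGroup S} {c : Fin N → FreeGroup S}
    (heq : torusProd X Y c (fun i j => cond (sgn (i, j)) (FreeGroup.of (emb (i, j)))
        (FreeGroup.of (emb (ι (i, j))))⁻¹) = 1) :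
    N * m ≤ 2 * Nat.card (GluedVertex ι) + 2 * N := by
  classical
  by_contra! hlt
  obtain ⟨M, rfl⟩ : ∃ M, N = M + 1 := ⟨N - 1, by omega⟩
  have : Fintype (GluedVertex ι) := Fintype.ofFinite _
  rw [Nat.card_eq_fintype_card] at hlt
  have hcard : 2 * Fintype.card {d // sgn d = true} = (M + 1) * m := by
    rw [two_mul_card_pos hι hsgn]
    simp [ZMod.card]
  let ext : ({d // sgn d = true} → ℚ) →ₗ[ℚ] (S → ℚ) :=
    Function.ExtendByZero.linearMap ℚ (fun d => emb d.1)
  have hinj : Function.Injective (fun d : {d // sgn d = true} => emb d.1) :=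
    hemb.comp Subtype.val_injective
  have hext : ∀ k (d : {d // sgn d = true}), ext k (emb d.1) = k d :=
    fun k d => hinj.extend_apply k 0 d
  let Λ : (({d // sgn d = true} → ℚ) × ℚ) →ₗ[ℚ]
      ((Fin M → ℚ) × (ℚ × ℚ)) × (GluedVertex ι → ℚ) :=
    LinearMap.prod
      (LinearMap.prod
        (LinearMap.pi fun i => (∑ j : ZMod m, sideWeight emb ι sgn (i.succ, j)) ∘ₗ ext ∘ₗ
          LinearMap.fst ℚ _ _)
        (LinearMap.prod (expSum X ∘ₗ ext ∘ₗ LinearMap.fst ℚ _ _)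
          (expSum Y ∘ₗ ext ∘ₗ LinearMap.fst ℚ _ _)))
      (LinearMap.pi fun v => potential emb ι sgn c v.out ∘ₗ ext ∘ₗ LinearMap.fst ℚ _ _ +
        LinearMap.snd ℚ _ _)
  have hker : LinearMap.ker Λ ≠ ⊥ := by
    apply LinearMap.ker_ne_bot_of_finrank_lt
    simp only [Module.finrank_prod, Module.finrank_fintype_fun_eq_card, Fintype.card_fin,
      Module.finrank_self]
    omega
  obtain ⟨⟨k, κ⟩, hmem, hne⟩ := (Submodule.ne_bot_iff _).1 hker
  rw [LinearMap.mem_ker] at hmem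
  have hΛ1 : ∀ i : Fin M, ∑ j : ZMod m, sideWeight emb ι sgn (i.succ, j) (ext k) = 0 := by
    intro i
    have := congrFun (congrArg (fun z => z.1.1) hmem) i
    simpa [Λ] using this
  have hX : expSum X (ext k) = 0 := congrArg (fun z => z.1.2.1) hmem
  have hY : expSum Y (ext k) = 0 := congrArg (fun z => z.1.2.2) hmem
  have hV : ∀ v : GluedVertex ι, potential emb ι sgn c v.out (ext k) + κ = 0 :=
    fun v => congrFun (congrArg (fun z => z.2) hmem) v
  have htot : ∑ d, sideWeight emb ι sgn d (ext k) = 0 := by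
    have e : ∑ d, sideWeight emb ι sgn (ι d) (ext k) = ∑ d, sideWeight emb ι sgn d (ext k) :=
      Equiv.sum_comp (Equiv.ofBijective ι (Function.Involutive.bijective hι))
        (fun d => sideWeight emb ι sgn d (ext k))
    simp only [sideWeight_pair hι hsgn, LinearMap.neg_apply, Finset.sum_neg_distrib] at e
    linarith
  have hface : ∀ i, ∑ j : ZMod m, sideWeight emb ι sgn (i, j) (ext k) = 0 := by
    intro i
    refine Fin.cases ?_ hΛ1 i
    rw [Fintype.sum_prod_type, Fin.sum_univ_succ] at htot
    simpa [hΛ1] using htot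
  have hquot : ∀ d, potential emb ι sgn c d (ext k) = -κ := by
    let P : GluedVertex ι → ℚ := Quot.lift (fun d => potential emb ι sgn c d (ext k)) (by
      rintro d _ rfl
      exact (potential_pair hemb hι hsgn heq (ext k) hX hY hface d).symm)
    intro d
    have h1 : P (Quot.mk _ d) = P (Quot.mk _ (Quot.out (Quot.mk _ d : GluedVertex ι))) := by
      rw [Quot.out_eq]
    have h2 := hV (Quot.mk _ d)
    change potential emb ι sgn c d (ext k) = potential emb ι sgn c _ (ext k) at h1
    linarith
  have hw : ∀ d, sideWeight emb ι sgn d (ext k) = 0 := by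
    intro d
    have := potential_nextSide c (ext k) hface d
    rw [hquot, hquot] at this
    linarith
  have hk : k = 0 := by
    funext d
    have := hw d.1
    rw [sideWeight, d.2] at this
    exact (hext k d).symm.trans this
  have hκ : κ = 0 := by
    have := hquot (0, 0)
    rw [hk] at this
    simpa using this
  exact hne (by rw [hk, hκ]; rfl)

/-- Counting sides around the vertices of a gluing whose sides are two-coloured with colours
alternating around each vertex: each vertex has even degree, and `M` is the set of sides at
vertices of degree greater than two. -/
theorem four_mul_card_gluedVertex_le {N m : ℕ} [NeZero m]
    {ι : Fin N × ZMod m → Fin N × ZMod m} {β : Type*} (col : Fin N × ZMod m → β)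
    (h2 : ∀ d, col (nextSide N m (ι d)) ≠ col d)
    (h3 : ∀ d, col (nextSide N m (ι (nextSide N m (ι d)))) = col d)
    (hinj : Function.Injective ι) (M : Finset (Fin N × ZMod m))
    (hM : ∀ d, d ∈ M ↔ nextSide N m (ι (nextSide N m (ι d))) ≠ d) :
    4 * Nat.card (GluedVertex ι) + M.card ≤ 2 * (N * m) := by
  classical
  have : Fintype (GluedVertex ι) := Fintype.ofFinite _
  rw [Nat.card_eq_fintype_card]
  set ν : Fin N × ZMod m → Fin N × ZMod m := fun d => nextSide N m (ι d) with hν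
  have hνinj : Function.Injective ν := (nextSide N m).injective.comp hinj
  let w : Fin N × ZMod m → ℕ := fun d => if d ∈ M then 1 else 2
  let π : Fin N × ZMod m → GluedVertex ι := Quot.mk _
  have hπ : ∀ d, π (ν d) = π d := fun d => (Quot.sound (r := fun d e => ν d = e) rfl).symm
  have hw1 : ∀ d, 1 ≤ w d := by
    intro d
    simp only [w]
    split_ifs <;> omega
  have hfib : ∀ v, 4 ≤ ∑ d with π d = v, w d := by
    intro v
    obtain ⟨d, rfl⟩ := Quot.exists_rep v
    by_cases hd : d ∈ M
    · have hd1 : ν (ν d) ≠ d := (hM d).1 hd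
      have hsub : ({d, ν d, ν (ν d), ν (ν (ν d))} : Finset _) ⊆
          Finset.univ.filter (fun e => π e = π d) := by
        intro e he
        simp only [Finset.mem_insert, Finset.mem_singleton] at he
        rcases he with rfl | rfl | rfl | rfl <;> simp [hπ]
      refine le_trans ?_ (Finset.sum_le_sum_of_subset hsub)
      have hcard : ({d, ν d, ν (ν d), ν (ν (ν d))} : Finset _).card = 4 := by
        have a1 : d ≠ ν d := fun h => h2 d (congrArg col h.symm)
        have a2 : d ≠ ν (ν (ν d)) := by
          intro h
          apply h2 (ν (ν d))
          change col (ν (ν (ν d))) = _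
          rw [← h]
          exact (h3 d).symm
        have a3 : ν d ≠ ν (ν d) := fun h => a1 (hνinj h)
        have a4 : ν (ν d) ≠ ν (ν (ν d)) := fun h => a3 (hνinj h)
        have a5 : ν d ≠ ν (ν (ν d)) := fun h => hd1 (hνinj h).symm
        rw [Finset.card_insert_of_notMem, Finset.card_insert_of_notMem,
          Finset.card_insert_of_notMem, Finset.card_singleton]
        · simpa using a4
        · simp [a3, a5]
        · simp [a1, a2, hd1.symm]
      calc 4 = ({d, ν d, ν (ν d), ν (ν (ν d))} : Finset _).card • 1 := by rw [hcard]; rfl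
        _ ≤ _ := Finset.card_nsmul_le_sum _ _ _ (fun x _ => hw1 x)
    · have hd1 : ν (ν d) = d := by
        by_contra h
        exact hd ((hM d).2 h)
      have hd2 : ν d ∉ M := fun h => (hM _).1 h (congrArg ν hd1)
      have hsub : ({d, ν d} : Finset _) ⊆ Finset.univ.filter (fun e => π e = π d) := by
        intro e he
        simp only [Finset.mem_insert, Finset.mem_singleton] at he
        rcases he with rfl | rfl <;> simp [hπ]
      refine le_trans ?_ (Finset.sum_le_sum_of_subset hsub)
      rw [Finset.sum_pair (fun h => h2 d (congrArg col h.symm))]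
      have e1 : w d = 2 := if_neg hd
      have e2 : w (ν d) = 2 := if_neg hd2
      exact (by rw [e1, e2] : 4 = w d + w (ν d)).le
  have hsum : ∑ v, ∑ d with π d = v, w d = ∑ d, w d := Finset.sum_fiberwise _ _ _
  have htot : ∑ d, w d + M.card = 2 * (N * m) := by
    have e : ∀ d, w d + (if d ∈ M then 1 else 0) = 2 := by
      intro d
      simp only [w]
      split_ifs <;> rfl
    have e1 : M.card = ∑ d, if d ∈ M then 1 else 0 := by simp
    rw [e1, ← Finset.sum_add_distrib, Finset.sum_congr rfl (fun d _ => e d)]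
    simp [ZMod.card, mul_comm]
  have : Fintype.card (GluedVertex ι) * 4 ≤ ∑ v, ∑ d with π d = v, w d := by
    rw [← smul_eq_mul]
    exact Finset.card_nsmul_le_sum _ _ _ (fun v _ => hfib v)
  omega

theorem faceProd_add_one {G : Type*} [Group G] {m : ℕ} [NeZero m] (v : ZMod m → G) :
    faceProd (fun t => v (t + 1)) = (v 0)⁻¹ * faceProd v * v 0 := by
  obtain ⟨k, rfl⟩ := Nat.exists_eq_succ_of_ne_zero (NeZero.ne m)
  have h1 : faceProd (fun t => v (t + 1)) =
      ((List.range k).map (fun j : ℕ => v ((j : ZMod (k + 1)) + 1))).prod * v 0 := by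
    have : (k : ZMod (k + 1)) + 1 = 0 := by
      have := ZMod.natCast_self (k + 1)
      push_cast at this
      exact this
    rw [faceProd, List.range_succ]
    simp [this]
  have h2 : faceProd v =
      v 0 * ((List.range k).map (fun j : ℕ => v ((j : ZMod (k + 1)) + 1))).prod := by
    rw [faceProd, List.range_succ_eq_map]
    simp [Function.comp_def]
  rw [h1, h2]
  group

theorem faceProd_add_eq_one {G : Type*} [Group G] {m : ℕ} [NeZero m] {v : ZMod m → G}
    (h : faceProd v = 1) (a : ZMod m) : faceProd (fun t => v (t + a)) = 1 := by
  have key : ∀ n : ℕ, faceProd (fun t => v (t + (n : ZMod m))) = 1 := by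
    intro n
    induction n with
    | zero => simpa using h
    | succ n ih =>
      have := faceProd_add_one (fun t => v (t + (n : ZMod m)))
      rw [ih] at this
      simp only [mul_one, inv_mul_cancel] at this
      rw [← this]
      congr 1
      funext t
      congr 1
      push_cast
      ring
  have := key a.val
  rwa [ZMod.natCast_zmod_val] at this

theorem faceProd_eq_one_of_add {G : Type*} [Group G] {m : ℕ} [NeZero m] {v : ZMod m → G}
    (a : ZMod m) (h : faceProd (fun t => v (t + a)) = 1) : faceProd v = 1 := by
  have := faceProd_add_eq_one h (-a)
  simpa using this

theorem faceProd_inv_reverse {G : Type*} [Group G] {m : ℕ} [NeZero m] {v v' : ZMod m → G}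
    {x y : ZMod m} (hv : faceProd v = 1) (h : ∀ t, v' (y - t) = (v (x + t))⁻¹) :
    faceProd v' = 1 := by
  apply faceProd_eq_one_of_add y
  have h1 := faceProd_add_eq_one hv (x + 1)
  obtain ⟨k, rfl⟩ := Nat.exists_eq_succ_of_ne_zero (NeZero.ne m)
  rw [← inv_inj, inv_one, ← h1, faceProd, List.prod_inv_reverse, faceProd, List.map_map,
    ← List.map_reverse, List.range_eq_range', List.reverse_range', List.map_map]
  congr 1
  rw [List.range_eq_range']
  apply List.map_congr_left
  intro j hj
  have hj' : j ≤ k := by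
    rw [List.mem_range'_1] at hj
    omega
  have e := h (-((k - j : ℕ) : ZMod (k + 1)))
  have hk : (k : ZMod (k + 1)) = -1 := by
    have := ZMod.natCast_self (k + 1)
    push_cast at this
    exact eq_neg_of_add_eq_zero_left this
  have e1 : y - -((k - j : ℕ) : ZMod (k + 1)) = ((0 + (k + 1) - 1 - j : ℕ) : ZMod (k + 1)) + y := by
    have : 0 + (k + 1) - 1 - j = k - j := by omega
    rw [this]
    ring
  have e2 : x + -((k - j : ℕ) : ZMod (k + 1)) = (j : ZMod (k + 1)) + (x + 1) := by
    rw [Nat.cast_sub hj', hk]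
    ring
  rw [e1, e2] at e
  simp only [Function.comp, Nat.succ_eq_add_one]
  rw [e, inv_inv]

theorem faceProd_eq_one_of_inv {G : Type*} [Group G] {m : ℕ} [NeZero m] (v : ZMod m → G)
    (x : ZMod m)
    (h : v x = ((List.range (m - 1)).map (fun t : ℕ => v ((t : ZMod m) + 1 + x))).prod⁻¹) :
    faceProd v = 1 := by
  apply faceProd_eq_one_of_add x
  obtain ⟨k, rfl⟩ := Nat.exists_eq_succ_of_ne_zero (NeZero.ne m)
  rw [faceProd, List.range_succ_eq_map, List.map_cons, List.prod_cons, Nat.cast_zero, zero_add, h,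
    List.map_map]
  simp [Function.comp_def]

/-- In a torus glued from faces with many sides, some sequence of `p` consecutive sides is glued to
a sequence of consecutive sides. -/
theorem exists_mirror_run {S : Type*} {N m p : ℕ} [NeZero m] (hN : 0 < N)
    (hm : 4 * (p - 1) < m)
    {emb : Fin N × ZMod m → S} {ι : Fin N × ZMod m → Fin N × ZMod m}
    {r : Fin N → ZMod m → Fin 2 × Bool} (hemb : Function.Injective emb) (hι : ∀ d, ι (ι d) = d)
    (hr : ∀ d, r (ι d).1 (ι d).2 = flipLetter (r d.1 d.2))
    (hcol : ∀ i j, (r i (j + 1)).1 ≠ (r i j).1) {X Y : FreeGroup S} {c : Fin N → FreeGroup S}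
    (heq : torusProd X Y c (fun i j => cond (r i j).2 (FreeGroup.of (emb (i, j)))
        (FreeGroup.of (emb (ι (i, j))))⁻¹) = 1) :
    ∃ d, ∀ t < p, ι (d.1, d.2 + (t : ZMod m)) = ((ι d).1, (ι d).2 - (t : ZMod m)) := by
  classical
  by_contra! hno
  have hV := card_gluedVertex_ge (sgn := fun d => (r d.1 d.2).2) hN hemb hι
    (fun d => by rw [hr]; rfl) heq
  have hstep : ∀ d, (r (nextSide N m (ι d)).1 (nextSide N m (ι d)).2).1 ≠ (r d.1 d.2).1 := by
    intro d
    have := hcol (ι d).1 (ι d).2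
    rw [hr] at this
    exact this
  set M : Finset (Fin N × ZMod m) :=
    Finset.univ.filter (fun d => nextSide N m (ι (nextSide N m (ι d))) ≠ d) with hMdef
  have hM4 := four_mul_card_gluedVertex_le (ι := ι) (fun d => (r d.1 d.2).1) hstep
    (fun d => by
      have h1 := hstep d
      have h2 := hstep (nextSide N m (ι d))
      omega) (Function.LeftInverse.injective hι) M (fun d => by
      rw [hMdef, Finset.mem_filter]
      simp only [Finset.mem_univ, true_and])
  have hhit : ∀ d : Fin N × ZMod m, ∃ t ∈ Finset.Ico 1 p, (d.1, d.2 + (t : ZMod m)) ∈ M := by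
    intro d
    by_contra! hnot
    obtain ⟨t, ht, hne⟩ := hno d
    apply hne
    induction t with
    | zero => simp
    | succ t ih =>
      have ih' : ι (d.1, d.2 + (t : ZMod m)) = ((ι d).1, (ι d).2 - (t : ZMod m)) := by
        by_contra h
        exact h (ih (by omega) h)
      have h1 := hnot (t + 1) (Finset.mem_Ico.2 ⟨by omega, ht⟩)
      rw [hMdef, Finset.mem_filter] at h1
      simp only [Finset.mem_univ, true_and, not_not] at h1
      have h2 : (d.1, d.2 + ((t + 1 : ℕ) : ZMod m)) = nextSide N m (d.1, d.2 + (t : ZMod m)) := by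
        rw [nextSide_apply]
        push_cast
        rw [add_assoc]
      conv_rhs at h1 => rw [h2]
      have h3 := congrArg ι ((nextSide N m).injective h1)
      rw [hι, ih'] at h3
      apply (nextSide N m).injective
      rw [h3, nextSide_apply]
      push_cast
      congr 1
      ring
  have hcount : N * m ≤ (p - 1) * M.card := by
    calc N * m = ∑ _d : Fin N × ZMod m, 1 := by simp [ZMod.card]
      _ ≤ ∑ d : Fin N × ZMod m, ∑ t ∈ Finset.Ico 1 p,
            if (d.1, d.2 + (t : ZMod m)) ∈ M then 1 else 0 := by
          apply Finset.sum_le_sum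
          intro d _
          obtain ⟨t, ht, hd⟩ := hhit d
          calc 1 = if (d.1, d.2 + (t : ZMod m)) ∈ M then 1 else 0 := by rw [if_pos hd]
            _ ≤ _ := Finset.single_le_sum
              (f := fun t : ℕ => if (d.1, d.2 + (t : ZMod m)) ∈ M then 1 else 0)
              (fun _ _ => Nat.zero_le _) ht
      _ = ∑ t ∈ Finset.Ico 1 p, ∑ d : Fin N × ZMod m,
            if (d.1, d.2 + (t : ZMod m)) ∈ M then 1 else 0 := Finset.sum_comm
      _ = ∑ t ∈ Finset.Ico 1 p, M.card := by
          apply Finset.sum_congr rfl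
          intro t _
          have : ∑ d : Fin N × ZMod m, (if (d.1, d.2 + (t : ZMod m)) ∈ M then 1 else 0) =
              ∑ d, if d ∈ M then 1 else 0 :=
            Equiv.sum_comp ((Equiv.refl (Fin N)).prodCongr (Equiv.addRight (t : ZMod m)))
              (fun d => if d ∈ M then 1 else 0)
          rw [this]
          simp
      _ = (p - 1) * M.card := by simp
  have h4 : M.card ≤ 4 * N := by omega
  have : (p - 1) * M.card ≤ (p - 1) * (4 * N) := Nat.mul_le_mul_left _ h4
  have h5 : (4 * (p - 1)) * N < m * N := Nat.mul_lt_mul_of_pos_right hm hN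
  nlinarith

/-- The product of a commutator with a list of conjugates of faces. -/
def listTorusProd {α : Type*} {m : ℕ} (R : Bool → ZMod m → α × Bool) (X Y : FreeGroup α)
    (L : List (FreeGroup α × Bool)) : FreeGroup α :=
  X * Y * X⁻¹ * Y⁻¹ *
    (L.map (fun z => z.1 * faceProd (fun j => FreeGroup.mk [R z.2 j]) * z.1⁻¹)).prod

theorem listTorusProd_map {α ι : Type*} {m : ℕ} (R : Bool → ZMod m → α × Bool) (X Y : FreeGroup α)
    (l : List ι) (f : ι → FreeGroup α × Bool) :
    listTorusProd R X Y (l.map f) = X * Y * X⁻¹ * Y⁻¹ *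
      (l.map (fun i => (f i).1 * faceProd (fun j => FreeGroup.mk [R (f i).2 j]) *
        (f i).1⁻¹)).prod := by
  rw [listTorusProd, List.map_map]
  rfl

theorem prod_map_filter_of_eq_one {ι G : Type*} [Group G] (p : ι → Bool) (f g : ι → G) (l : List ι)
    (h1 : ∀ i, p i = false → f i = 1) (h2 : ∀ i, p i = true → f i = g i) :
    (l.map f).prod = ((l.filter p).map g).prod := by
  induction l with
  | nil => rfl
  | cons a l ih =>
    cases h : p a
    · rw [List.filter_cons_of_neg (by simp [h]), List.map_cons, List.prod_cons, h1 a h, ih, one_mul]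
    · rw [List.filter_cons_of_pos h, List.map_cons, List.prod_cons, h2 a h, ih, List.map_cons,
        List.prod_cons]

/-- Cancelling two mirrored faces of an unfolded torus. -/
theorem exists_shorter_of_mirror {S α G : Type*} [Group G] {N m : ℕ} [NeZero m]
    (R : Bool → ZMod m → α × Bool) (q : FreeGroup α →* G)
    (hq : ∀ s, q (faceProd (fun j => FreeGroup.mk [R s j])) = 1) {s : Fin N → Bool}
    {emb : Fin N × ZMod m → S} {lab : S → α × Bool} {ι : Fin N × ZMod m → Fin N × ZMod m}
    {X Y : FreeGroup S} {c : Fin N → FreeGroup S} (hemb : Function.Injective emb)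
    (hlab : ∀ d, lab (emb d) = R (s d.1) d.2) (hι : ∀ d, ι (ι d) = d)
    (hr : ∀ d, R (s (ι d).1) (ι d).2 = flipLetter (R (s d.1) d.2))
    (heq : torusProd X Y c (fun i j => cond (R (s i) j).2 (FreeGroup.of (emb (i, j)))
        (FreeGroup.of (emb (ι (i, j))))⁻¹) = 1)
    (d : Fin N × ZMod m) (hd : (R (s d.1) d.2).2 = true) (hne : (ι d).1 ≠ d.1)
    (hmir : ∀ t, R (s (ι d).1) ((ι d).2 - t) = flipLetter (R (s d.1) (d.2 + t))) :
    ∃ (X' Y' : FreeGroup α) (L : List (FreeGroup α × Bool)),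
      q X' = q (FreeGroup.lift (fun t => FreeGroup.mk [lab t]) X) ∧
      q Y' = q (FreeGroup.lift (fun t => FreeGroup.mk [lab t]) Y) ∧ L.length < N ∧
      listTorusProd R X' Y' L = 1 := by
  classical
  obtain ⟨k, x⟩ := d
  obtain ⟨k', y, hd'⟩ : ∃ k' y, ι (k, x) = (k', y) := ⟨_, _, rfl⟩
  simp only [hd'] at hne hmir
  simp only at hne hmir hd
  set A : FreeGroup α := ((List.range (m - 1)).map
    (fun t : ℕ => FreeGroup.mk [R (s k) ((t : ZMod m) + 1 + x)])).prod with hA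
  let f : S → FreeGroup α := Function.update (fun t => FreeGroup.mk [lab t]) (emb (k, x)) A⁻¹
  let ψ : FreeGroup S →* FreeGroup α := FreeGroup.lift f
  have hfx : f (emb (k, x)) = A⁻¹ := Function.update_self _ _ _
  have hfne : ∀ e, e ≠ (k, x) → f (emb e) = FreeGroup.mk [R (s e.1) e.2] := by
    intro e he
    simp only [f]
    rw [Function.update_of_ne (fun h => he (hemb h)), hlab]
  let v : Fin N → ZMod m → FreeGroup α := fun i j => ψ (cond (R (s i) j).2
    (FreeGroup.of (emb (i, j))) (FreeGroup.of (emb (ι (i, j))))⁻¹)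
  have hvx : v k x = A⁻¹ := by simp [v, hd, ψ, hfx]
  have hvne : ∀ i j, (i, j) ≠ (k, x) → (i, j) ≠ (k', y) → v i j = FreeGroup.mk [R (s i) j] := by
    intro i j h1 h2
    have h3 : ι (i, j) ≠ (k, x) := by
      intro h
      apply h2
      rw [← hd', ← h, hι]
    cases hb : (R (s i) j).2
    · simp only [v, hb, cond_false, map_inv, ψ, FreeGroup.lift_apply_of, hfne _ h3, hr,
        mk_flipLetter, inv_inv]
    · simp only [v, hb, cond_true, ψ, FreeGroup.lift_apply_of, hfne _ h1]
  have hvy : v k' y = A := by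
    have h1 := hmir 0
    simp only [sub_zero, add_zero] at h1
    have h2 : ι (k', y) = (k, x) := by rw [← hd', hι]
    simp [v, h1, hd, h2, ψ, hfx]
  have hface : faceProd (v k) = 1 := by
    apply faceProd_eq_one_of_inv _ x
    rw [hvx, hA]
    congr 2
    apply List.map_congr_left
    intro t ht
    rw [List.mem_range] at ht
    rw [hvne]
    · intro h
      simp only [Prod.mk.injEq, true_and, add_eq_right] at h
      have h1 : ((t + 1 : ℕ) : ZMod m) = 0 := by exact_mod_cast h
      rw [ZMod.natCast_eq_zero_iff] at h1
      have := Nat.le_of_dvd (by omega) h1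
      omega
    · intro h
      exact hne (congrArg Prod.fst h).symm
  have hface' : faceProd (v k') = 1 := by
    refine faceProd_inv_reverse (x := x) (y := y) hface (fun t => ?_)
    by_cases ht : t = 0
    · rw [ht, sub_zero, add_zero, hvx, hvy, inv_inv]
    · rw [hvne, hvne, hmir, mk_flipLetter]
      · simpa using ht
      · intro h
        exact hne (congrArg Prod.fst h).symm
      · intro h
        exact hne (congrArg Prod.fst h)
      · simpa using ht
  have hqψ : q.comp ψ = q.comp (FreeGroup.lift (fun t => FreeGroup.mk [lab t])) := by
    apply FreeGroup.ext_hom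
    intro e
    simp only [MonoidHom.comp_apply, ψ, FreeGroup.lift_apply_of]
    by_cases he : e = emb (k, x)
    · rw [he, hfx, hlab]
      have h1 : faceProd (fun j => q (FreeGroup.mk [R (s k) j])) = 1 := by
        rw [← hq (s k), map_faceProd]
      have h2 := faceProd_add_eq_one h1 x
      obtain ⟨n, rfl⟩ := Nat.exists_eq_succ_of_ne_zero (NeZero.ne m)
      rw [faceProd, List.range_succ_eq_map, List.map_cons, List.prod_cons, List.map_map] at h2
      rw [map_inv, hA, map_list_prod, List.map_map]
      have h3 := eq_inv_of_mul_eq_one_left h2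
      rw [Nat.cast_zero, zero_add] at h3
      rw [h3]
      simp [Function.comp_def]
    · simp only [f, Function.update_of_ne he]
  have hrel := congrArg ψ heq
  rw [map_torusProd, map_one] at hrel
  change torusProd (ψ X) (ψ Y) (fun i => ψ (c i)) v = 1 at hrel
  refine ⟨ψ X, ψ Y, ((List.finRange N).filter (fun i => i ≠ k ∧ i ≠ k')).map
    (fun i => (ψ (c i), s i)), DFunLike.congr_fun hqψ X, DFunLike.congr_fun hqψ Y, ?_, ?_⟩
  · rw [List.length_map]
    conv_rhs => rw [← List.length_finRange (n := N)]
    rw [List.length_filter_lt_length_iff_exists]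
    exact ⟨k, List.mem_finRange k, by simp⟩
  · rw [listTorusProd_map, ← hrel, torusProd]
    congr 1
    symm
    apply prod_map_filter_of_eq_one
    · intro i hi
      have : i = k ∨ i = k' := by
        rw [decide_eq_false_iff_not] at hi
        tauto
      rcases this with rfl | rfl
      · rw [hface]; group
      · rw [hface']; group
    · intro i hi
      rw [decide_eq_true_iff] at hi
      have : v i = fun j => FreeGroup.mk [R (s i) j] := by
        funext j
        exact hvne i j (fun h => hi.1 (congrArg Prod.fst h)) (fun h => hi.2 (congrArg Prod.fst h))
      rw [this]

/-- If faces can match along `p` consecutive sides only when they are mirror images of each other,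
every torus relation comes from a pair of commuting elements of the free group. -/
theorem exists_commuting_lifts {G : Type*} [Group G] {m p : ℕ} [NeZero m] (hm : 4 * (p - 1) < m)
    (R : Bool → ZMod m → Fin 2 × Bool) (q : FreeGroup (Fin 2) →* G)
    (hq : ∀ s, q (faceProd (fun j => FreeGroup.mk [R s j])) = 1)
    (hcol : ∀ s j, (R s (j + 1)).1 ≠ (R s j).1)
    (hpiece : ∀ s s' x y, (∀ t < p, R s' (y - (t : ZMod m)) = flipLetter (R s (x + (t : ZMod m)))) →
      s' ≠ s ∧ ∀ t, R s' (y - t) = flipLetter (R s (x + t)))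
    (L : List (FreeGroup (Fin 2) × Bool)) (X Y : FreeGroup (Fin 2))
    (h : listTorusProd R X Y L = 1) :
    ∃ X' Y' : FreeGroup (Fin 2), q X' = q X ∧ q Y' = q Y ∧ X' * Y' = Y' * X' := by
  generalize hn : L.length = n
  induction n using Nat.strong_induction_on generalizing L X Y with
  | _ n ih =>
  rcases Nat.eq_zero_or_pos n with rfl | hpos
  · rw [List.length_eq_zero_iff] at hn
    subst hn
    refine ⟨X, Y, rfl, rfl, ?_⟩
    simp only [listTorusProd, List.map_nil, List.prod_nil, mul_one] at h
    exact mul_inv_eq_iff_eq_mul.1 (mul_inv_eq_one.1 h)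
  · have h' : torusProd X Y (fun i : Fin L.length => (L.get i).1)
        (fun i j => FreeGroup.mk [R (L.get i).2 j]) = 1 := by
      rw [← h]
      conv_rhs => rw [← List.map_get_finRange L]
      rw [listTorusProd_map]
      rfl
    obtain ⟨S, emb, lab, ι, X₁, Y₁, c, hemb, hlab, hι, hr, hX, hY, -, heq⟩ :=
      exists_torus_unfolding X Y _ (fun i j => R (L.get i).2 j) h'
    obtain ⟨d, hd⟩ := exists_mirror_run (p := p) (by omega) hm hemb hι hr
      (fun i j => hcol _ j) heq
    have hmir := hpiece (L.get d.1).2 (L.get (ι d).1).2 d.2 (ι d).2 (fun t ht => by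
      have := hr (d.1, d.2 + (t : ZMod m))
      rwa [hd t ht] at this)
    have hne : (ι d).1 ≠ d.1 := fun e => hmir.1 (by rw [e])
    have hshort : ∃ (X' Y' : FreeGroup (Fin 2)) (L' : List (FreeGroup (Fin 2) × Bool)),
        q X' = q X ∧ q Y' = q Y ∧ L'.length < n ∧ listTorusProd R X' Y' L' = 1 := by
      rw [← hX, ← hY, ← hn]
      cases hs : (R (L.get d.1).2 d.2).2
      · refine exists_shorter_of_mirror R q hq hemb hlab hι hr heq (ι d) ?_ ?_ (fun t => ?_)
        · rw [hr, flipLetter_snd, hs]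
          rfl
        · rw [hι]
          exact hne.symm
        · have := hmir.2 (-t)
          rw [sub_neg_eq_add, ← sub_eq_add_neg] at this
          rw [hι, this, flipLetter_flipLetter]
      · exact exists_shorter_of_mirror R q hq hemb hlab hι hr heq d hs hne hmir.2
    obtain ⟨X', Y', L', h1, h2, h3, h4⟩ := hshort
    obtain ⟨X'', Y'', h5, h6, h7⟩ := ih _ h3 L' X' Y' h4 rfl
    exact ⟨X'', Y'', h5.trans h1, h6.trans h2, h7⟩

theorem FreeGroup.eq_of_commute_of {α : Type*} {a b : α}
    (h : FreeGroup.of a * FreeGroup.of b = FreeGroup.of b * FreeGroup.of a) : a = b := by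
  classical
  by_contra hne
  have h1 := congrArg (FreeGroup.lift
    (fun x => if x = a then Equiv.swap (0 : Fin 3) 1 else Equiv.swap (1 : Fin 3) 2)) h
  simp only [_root_.map_mul, FreeGroup.lift_apply_of, if_true, if_neg (Ne.symm hne)] at h1
  revert h1
  decide

theorem FreeGroup.exists_zpow_eq_of_subsingleton {α : Type*} [Subsingleton α] (X Y : FreeGroup α) :
    ∃ i j : ℤ, (i ≠ 0 ∨ j ≠ 0) ∧ X ^ i = Y ^ j := by
  have key : ∃ z : FreeGroup α, ∀ g, ∃ n : ℤ, g = z ^ n := by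
    by_cases hα : Nonempty α
    · obtain ⟨a⟩ := hα
      refine ⟨FreeGroup.of a, fun g => ?_⟩
      induction g using FreeGroup.induction_on with
      | C1 => exact ⟨0, by simp⟩
      | of s => exact ⟨1, by rw [Subsingleton.elim s a, zpow_one]⟩
      | inv_of s _ => exact ⟨-1, by rw [Subsingleton.elim s a]; simp⟩
      | mul x y hx hy =>
        obtain ⟨i, hi⟩ := hx
        obtain ⟨j, hj⟩ := hy
        exact ⟨i + j, by rw [zpow_add, ← hi, ← hj]⟩
    · have : IsEmpty α := not_nonempty_iff.1 hα
      exact ⟨1, fun g => ⟨0, Subsingleton.elim _ _⟩⟩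
  obtain ⟨z, hz⟩ := key
  obtain ⟨i, hi⟩ := hz X
  obtain ⟨j, hj⟩ := hz Y
  by_cases h0 : i = 0
  · exact ⟨1, 0, by simp, by simp [hi, h0]⟩
  · exact ⟨j, i, Or.inr h0, by rw [hi, hj, ← zpow_mul, ← zpow_mul, mul_comm]⟩

/-- Commuting elements of a free group satisfy a nontrivial relation between their powers. -/
theorem FreeGroup.exists_zpow_eq_of_commute {α : Type*} {X Y : FreeGroup α} (h : X * Y = Y * X) :
    ∃ i j : ℤ, (i ≠ 0 ∨ j ≠ 0) ∧ X ^ i = Y ^ j := by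
  let H := Subgroup.closure {X, Y}
  have hcomm : ∀ a b : H, a * b = b * a := by
    have := Subgroup.isMulCommutative_closure (k := {X, Y}) (by
      rintro x (rfl | rfl) y (rfl | rfl)
      · rfl
      · exact h
      · exact h.symm
      · rfl)
    exact fun a b => mul_comm' a b
  let e : H ≃* FreeGroup (IsFreeGroup.Generators H) := IsFreeGroup.toFreeGroup H
  have hsub : Subsingleton (IsFreeGroup.Generators H) := by
    refine ⟨fun a b => FreeGroup.eq_of_commute_of ?_⟩
    apply e.symm.injective
    rw [_root_.map_mul, _root_.map_mul, hcomm]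
  have hX : X ∈ H := Subgroup.subset_closure (by simp)
  have hY : Y ∈ H := Subgroup.subset_closure (by simp)
  obtain ⟨i, j, hij, hpow⟩ := FreeGroup.exists_zpow_eq_of_subsingleton (e ⟨X, hX⟩) (e ⟨Y, hY⟩)
  refine ⟨i, j, hij, ?_⟩
  rw [← map_zpow, ← map_zpow] at hpow
  exact congrArg Subtype.val (e.injective hpow)

theorem not_injective_of_zpow_eq {G : Type*} [Group G]
    (f : (Multiplicative ℤ × Multiplicative ℤ) →* G) {i j : ℤ} (hij : i ≠ 0 ∨ j ≠ 0)
    (h : f (Multiplicative.ofAdd 1, 1) ^ i = f (1, Multiplicative.ofAdd 1) ^ j) :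
    ¬ Function.Injective f := by
  intro hf
  rw [← map_zpow, ← map_zpow] at h
  have h1 := hf h
  rw [Prod.pow_mk, Prod.pow_mk, one_zpow, one_zpow, Prod.mk.injEq, ← ofAdd_zsmul,
    ← ofAdd_zsmul] at h1
  have h2 : i = 0 := by simpa using h1.1
  have h3 : j = 0 := by simpa using h1.2.symm
  exact hij.elim (· h2) (· h3)

/-- Elements of the normal closure of `u`, as products of conjugates of `u` and `u⁻¹`. -/
theorem exists_list_of_mem_normalClosure {G : Type*} [Group G] (w : Bool → G)
    (hw : w false = (w true)⁻¹) {g : G} (hg : g ∈ Subgroup.normalClosure {w true}) :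
    ∃ L : List (G × Bool), (L.map (fun z => z.1 * w z.2 * z.1⁻¹)).prod = g := by
  refine Subgroup.closure_induction (p := fun g _ => ∃ L : List (G × Bool),
    (L.map (fun z => z.1 * w z.2 * z.1⁻¹)).prod = g) ?_ ?_ ?_ ?_ hg
  · intro x hx
    obtain ⟨y, hy, hxy⟩ := Group.mem_conjugatesOfSet_iff.1 hx
    rw [Set.mem_singleton_iff] at hy
    subst hy
    obtain ⟨c, hc⟩ := isConj_iff.1 hxy
    exact ⟨[(c, true)], by simpa using hc⟩
  · exact ⟨[], rfl⟩
  · rintro x y _ _ ⟨L, rfl⟩ ⟨L', rfl⟩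
    exact ⟨L ++ L', by simp⟩
  · rintro x _ ⟨L, rfl⟩
    refine ⟨(L.map (fun z => (z.1, !z.2))).reverse, ?_⟩
    rw [List.prod_inv_reverse, List.map_reverse, List.map_map, List.map_map]
    congr 2
    apply List.map_congr_left
    rintro ⟨c, _ | _⟩ _ <;> simp [hw, mul_assoc]

/-- The letters of the bi-infinite periodic word `⋯ u_s u_s u_s ⋯`. -/
def cyclicLetter (q p x : ℤ) : Fin 2 × Bool :=
  (if x % 2 = 0 then 0 else 1,
    if p ∣ x then decide (2 * p ∣ x) else decide (x * q / p % 2 = 0))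

theorem cyclicLetter_fst_eq_iff {q p x y : ℤ} :
    (cyclicLetter q p x).1 = (cyclicLetter q p y).1 ↔ x % 2 = y % 2 := by
  simp only [cyclicLetter]
  have := Int.emod_two_eq_zero_or_one x
  have := Int.emod_two_eq_zero_or_one y
  split_ifs <;> simp <;> omega

theorem cyclicLetter_of_not_dvd {q p x : ℤ} (h : ¬ p ∣ x) :
    (cyclicLetter q p x).2 = decide (x * q / p % 2 = 0) := by
  simp [cyclicLetter, h]

theorem cyclicLetter_add {q p x k : ℤ} (hp : 0 < p) (h : 2 * p ∣ k) :
    cyclicLetter q p (x + k) = cyclicLetter q p x := by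
  obtain ⟨k, rfl⟩ := h
  have h1 : (x + 2 * p * k) % 2 = x % 2 := by
    rw [mul_assoc, Int.add_mul_emod_self_left]
  have h2 : p ∣ x + 2 * p * k ↔ p ∣ x := by
    rw [show 2 * p * k = p * (2 * k) by ring]
    exact dvd_add_left (dvd_mul_right _ _)
  have h3 : 2 * p ∣ x + 2 * p * k ↔ 2 * p ∣ x :=
    dvd_add_left (dvd_mul_right _ _)
  have h4 : (x + 2 * p * k) * q / p % 2 = x * q / p % 2 := by
    rw [show (x + 2 * p * k) * q = x * q + p * (2 * (k * q)) by ring,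
      Int.add_mul_ediv_left _ _ hp.ne', Int.add_mul_emod_self_left]
  simp only [cyclicLetter, h1, h2, h3, h4]

theorem exists_emod_eq {q p : ℤ} (hp : 0 < p) (hcop : IsCoprime q p) (a ρ : ℤ) :
    ∃ t, 0 ≤ t ∧ t < p ∧ ∃ k, (a + t) * q = p * k + ρ := by
  obtain ⟨u, v, huv⟩ := hcop
  refine ⟨(u * ρ - a) % p, Int.emod_nonneg _ hp.ne', Int.emod_lt_of_pos _ hp,
    -(v * ρ) - (u * ρ - a) / p * q, ?_⟩
  have := Int.emod_def (u * ρ - a) p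
  rw [this]
  linear_combination ρ * huv

/-- Two windows of length `p` on which the signs agree differ by a period. -/
theorem dvd_sub_of_parity_eq {q p : ℤ} (hp : 2 ≤ p) (hcop : IsCoprime q p) {a c : ℤ}
    (hac : 2 ∣ c - a)
    (h : ∀ t, 0 ≤ t → t < p → ¬ p ∣ a + t → ¬ p ∣ c + t →
      (a + t) * q / p % 2 = (c + t) * q / p % 2) : 2 * p ∣ c - a := by
  set e := (c - a) * q % (2 * p) with he
  set D := (c - a) * q / (2 * p) with hD
  have hdec : (c - a) * q = 2 * p * D + e := (Int.mul_ediv_add_emod _ _).symm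
  have he0 : 0 ≤ e := Int.emod_nonneg _ (by omega)
  have he1 : e < 2 * p := Int.emod_lt_of_pos _ (by omega)
  have he2 : 2 ∣ e := by
    have h1 : e = (c - a) * q - 2 * (p * D) := by rw [hdec]; ring
    rw [h1]
    exact dvd_sub (Dvd.dvd.mul_right hac q) (dvd_mul_right _ _)
  by_cases hz : e = 0
  · have h1 : 2 * p ∣ (c - a) * q := ⟨D, by rw [hdec, hz, add_zero]⟩
    have h2 : p ∣ c - a := hcop.symm.dvd_of_dvd_mul_right ((dvd_mul_left p 2).trans h1)
    rcases Int.even_or_odd p with hpe | hpo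
    · have hq : IsCoprime (2 : ℤ) q := hcop.symm.of_isCoprime_of_dvd_left hpe.two_dvd
      exact (IsCoprime.mul_left hq hcop.symm).dvd_of_dvd_mul_right h1
    · have : IsCoprime (2 : ℤ) p := by
        rw [Int.isCoprime_iff_gcd_eq_one, Int.gcd_comm]
        obtain ⟨k, rfl⟩ := hpo
        simp
      exact this.mul_dvd hac h2
  · exfalso
    have key : ∀ ρ, 0 < ρ → ρ < p → p < ρ + e → ρ + e < 2 * p → False := by
      intro ρ hρ0 hρ1 hρ2 hρ3
      obtain ⟨t, ht0, ht1, k, hk⟩ := exists_emod_eq (by omega) hcop a ρ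
      have hc : (c + t) * q = p * (k + 2 * D + 1) + (ρ + e - p) := by
        linear_combination hk + hdec
      have n1 : ¬ p ∣ a + t := by
        intro hd
        have h1 : p ∣ p * k + ρ := hk ▸ Dvd.dvd.mul_right hd q
        have := Int.le_of_dvd hρ0 ((dvd_add_right (dvd_mul_right _ _)).1 h1)
        omega
      have n2 : ¬ p ∣ c + t := by
        intro hd
        have h1 : p ∣ p * (k + 2 * D + 1) + (ρ + e - p) := hc ▸ Dvd.dvd.mul_right hd q
        have := Int.le_of_dvd (by omega) ((dvd_add_right (dvd_mul_right _ _)).1 h1)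
        omega
      have f1 : (a + t) * q / p = k := by
        rw [hk, Int.mul_add_ediv_left _ _ (by omega), Int.ediv_eq_zero_of_lt hρ0.le hρ1, add_zero]
      have f2 : (c + t) * q / p = k + 2 * D + 1 := by
        rw [hc, Int.mul_add_ediv_left _ _ (by omega),
          Int.ediv_eq_zero_of_lt (by omega) (by omega), add_zero]
      have := h t ht0 ht1 n1 n2
      rw [f1, f2] at this
      omega
    rcases lt_or_ge e p with hlt | hge
    · exact key (p - 1) (by omega) (by omega) (by omega) (by omega)
    · exact key 1 (by omega) (by omega) (by omega) (by omega)

theorem dvd_sub_of_cyclicLetter_eq {q p : ℤ} (hp : 2 ≤ p) (hcop : IsCoprime q p) {a c : ℤ}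
    (h : ∀ t, 0 ≤ t → t < p → cyclicLetter q p (c + t) = cyclicLetter q p (a + t)) :
    2 * p ∣ c - a := by
  refine dvd_sub_of_parity_eq hp hcop ?_ (fun t h0 h1 n1 n2 => ?_)
  · have := cyclicLetter_fst_eq_iff.1 (congrArg Prod.fst (h 0 le_rfl (by omega)))
    omega
  · have := congrArg Prod.snd (h t h0 h1)
    rw [cyclicLetter_of_not_dvd n1, cyclicLetter_of_not_dvd n2, decide_eq_decide] at this
    omega

theorem neg_ediv_of_not_dvd {p y : ℤ} (hp : 0 < p) (h : ¬ p ∣ y) : -y / p = -(y / p) - 1 := by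
  rw [Int.neg_ediv, if_neg h, Int.sign_eq_one_of_pos hp]

theorem not_forall_cyclicLetter_eq_flip {q p : ℤ} (hp : 2 ≤ p) (hcop : IsCoprime q p) {a b : ℤ} :
    ¬ ∀ t, 0 ≤ t → t < p →
      cyclicLetter q p (a + t) = flipLetter (cyclicLetter q p (b - t)) := by
  intro h
  have hab : 2 * p ∣ -b - a := by
    refine dvd_sub_of_parity_eq hp hcop ?_ (fun t h0 h1 n1 n2 => ?_)
    · have h3 := congrArg Prod.fst (h 0 le_rfl (by omega))
      rw [flipLetter_fst, cyclicLetter_fst_eq_iff] at h3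
      omega
    · have n3 : ¬ p ∣ b - t := by rwa [← dvd_neg, neg_sub, sub_eq_neg_add]
      have n4 : ¬ p ∣ (b - t) * q := fun hd => n3 (hcop.symm.dvd_of_dvd_mul_right hd)
      have := congrArg Prod.snd (h t h0 h1)
      rw [flipLetter_snd, cyclicLetter_of_not_dvd n1, cyclicLetter_of_not_dvd n3,
        ← decide_not, decide_eq_decide] at this
      rw [show (-b + t) * q = -((b - t) * q) by ring, neg_ediv_of_not_dvd (by omega) n4]
      omega
  obtain ⟨t, h0, h1, k, hk⟩ := exists_emod_eq (q := 1) (by omega : 0 < p) isCoprime_one_left a 0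
  have ha : p ∣ a + t := ⟨k, by linarith⟩
  have hb : p ∣ b - t := by
    have : b - t = -(-b - a) - (a + t) := by ring
    rw [this]
    exact dvd_sub ((dvd_mul_left p 2).trans hab).neg_right ha
  have h2 : 2 * p ∣ a + t ↔ 2 * p ∣ b - t := by
    have : b - t = -(-b - a) - (a + t) := by ring
    rw [this]
    exact (dvd_sub_right hab.neg_right).symm
  have := congrArg Prod.snd (h t h0 h1)
  simp only [flipLetter, cyclicLetter, ha, hb, if_true, h2] at this
  cases hdec : decide (2 * p ∣ b - t) <;> simp [hdec] at this

/-- The sides of a positively or negatively oriented face of an Heckoid relation. -/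
def faceLetter (q p : ℤ) (m : ℕ) (s : Bool) (j : ZMod m) : Fin 2 × Bool :=
  cond s (cyclicLetter q p j.val) (flipLetter (cyclicLetter q p (-1 - j.val)))

theorem cyclicLetter_congr {q p x y : ℤ} (hp : 0 < p) (h : 2 * p ∣ x - y) :
    cyclicLetter q p x = cyclicLetter q p y := by
  rw [← cyclicLetter_add (x := y) hp h, add_sub_cancel]

section FaceLetter

variable {q p : ℤ} {m : ℕ} [NeZero m]

theorem faceLetter_true (hp : 0 < p) (hm : 2 * p ∣ m) (x : ℤ) :
    faceLetter q p m true (x : ZMod m) = cyclicLetter q p x := by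
  refine cyclicLetter_congr hp ?_
  rw [ZMod.val_intCast, Int.emod_def]
  have : x - m * (x / m) - x = -(m * (x / m)) := by ring
  rw [this]
  exact (hm.mul_right _).neg_right

theorem faceLetter_false (hp : 0 < p) (hm : 2 * p ∣ m) (x : ℤ) :
    faceLetter q p m false (x : ZMod m) = flipLetter (cyclicLetter q p (-1 - x)) := by
  refine congrArg flipLetter (cyclicLetter_congr hp ?_)
  rw [ZMod.val_intCast, Int.emod_def]
  have : -1 - (x - m * (x / m)) - (-1 - x) = m * (x / m) := by ring
  rw [this]
  exact hm.mul_right _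

theorem exists_intCast_eq (j : ZMod m) : ∃ x : ℤ, j = (x : ZMod m) :=
  ⟨j.val, by simp⟩

theorem faceLetter_add_one_fst_ne (hp : 0 < p) (hm : 2 * p ∣ m) (s : Bool) (j : ZMod m) :
    (faceLetter q p m s (j + 1)).1 ≠ (faceLetter q p m s j).1 := by
  obtain ⟨x, rfl⟩ := exists_intCast_eq j
  have : (x : ZMod m) + 1 = ((x + 1 : ℤ) : ZMod m) := by push_cast; rfl
  rw [this]
  cases s
  · rw [faceLetter_false hp hm, faceLetter_false hp hm, flipLetter_fst, flipLetter_fst, Ne,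
      cyclicLetter_fst_eq_iff]
    omega
  · rw [faceLetter_true hp hm, faceLetter_true hp hm, Ne, cyclicLetter_fst_eq_iff]
    omega

theorem faceLetter_mirror (hp : 2 ≤ p) (hcop : IsCoprime q p) (hm : 2 * p ∣ m) (s s' : Bool)
    (x y : ZMod m) (h : ∀ t < p.toNat, faceLetter q p m s' (y - (t : ZMod m)) =
      flipLetter (faceLetter q p m s (x + (t : ZMod m)))) :
    s' ≠ s ∧ ∀ t, faceLetter q p m s' (y - t) = flipLetter (faceLetter q p m s (x + t)) := by
  have hp0 : 0 < p := by omega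
  obtain ⟨x, rfl⟩ := exists_intCast_eq x
  obtain ⟨y, rfl⟩ := exists_intCast_eq y
  have h' : ∀ t : ℤ, 0 ≤ t → t < p → faceLetter q p m s' ((y - t : ℤ) : ZMod m) =
      flipLetter (faceLetter q p m s ((x + t : ℤ) : ZMod m)) := by
    intro t h0 h1
    have := h t.toNat (by omega)
    have e : ((t.toNat : ℕ) : ZMod m) = (t : ZMod m) := by
      rw [← Int.cast_natCast, Int.toNat_of_nonneg h0]
    rw [e] at this
    push_cast
    exact this
  suffices s' ≠ s ∧ ∀ t : ℤ, faceLetter q p m s' ((y - t : ℤ) : ZMod m) =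
      flipLetter (faceLetter q p m s ((x + t : ℤ) : ZMod m)) by
    refine ⟨this.1, fun t => ?_⟩
    obtain ⟨t, rfl⟩ := exists_intCast_eq t
    exact_mod_cast this.2 t
  cases s <;> cases s' <;>
    simp only [faceLetter_true hp0 hm, faceLetter_false hp0 hm, flipLetter_flipLetter] at h' ⊢
  · exfalso
    refine not_forall_cyclicLetter_eq_flip hp hcop (a := -1 - y) (b := -1 - x) (fun t h0 h1 => ?_)
    have := congrArg flipLetter (h' t h0 h1)
    rw [flipLetter_flipLetter] at this
    rw [show -1 - y + t = -1 - (y - t) by ring, this, show -1 - x - t = -1 - (x + t) by ring]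
  · have hd : 2 * p ∣ (y - (p - 1)) - (-1 - x - (p - 1)) := by
      refine dvd_sub_of_cyclicLetter_eq hp hcop (fun t h0 h1 => ?_)
      have := h' (p - 1 - t) (by omega) (by omega)
      rw [show y - (p - 1) + t = y - (p - 1 - t) by ring, this]
      congr 1
      ring
    refine ⟨by simp, fun t => cyclicLetter_congr hp0 ?_⟩
    convert hd using 1
    ring
  · have hd : 2 * p ∣ (-1 - y) - x := by
      refine dvd_sub_of_cyclicLetter_eq hp hcop (fun t h0 h1 => ?_)
      have := flipLetter_injective (h' t h0 h1)
      rw [← this]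
      congr 1
      ring
    refine ⟨by simp, fun t => congrArg flipLetter (cyclicLetter_congr hp0 ?_)⟩
    convert hd using 1
    ring
  · exfalso
    refine not_forall_cyclicLetter_eq_flip hp hcop (a := x) (b := y) (fun t h0 h1 => ?_)
    rw [h' t h0 h1, flipLetter_flipLetter]

end FaceLetter

theorem inv_prod_map_range {G : Type*} [Group G] (f : ℕ → G) (k : ℕ) :
    ((List.range k).map f).prod⁻¹ = ((List.range k).map (fun j => (f (k - 1 - j))⁻¹)).prod := by
  induction k with
  | zero => simp
  | succ k ih =>
    rw [List.prod_range_succ, mul_inv_rev, ih, List.prod_range_succ']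
    simp only [add_tsub_cancel_right, tsub_zero]
    congr 2
    refine List.map_congr_left fun j _ => ?_
    rw [Nat.sub_sub, add_comm]

theorem prod_map_range_mul {G : Type*} [Group G] (f : ℕ → G) {k : ℕ} (hf : ∀ j, f (k + j) = f j)
    (n : ℕ) : ((List.range (k * n)).map f).prod = ((List.range k).map f).prod ^ n := by
  induction n with
  | zero => simp
  | succ n ih =>
    rw [mul_add_one, add_comm, List.range_add, List.map_append, List.prod_append, List.map_map,
      pow_succ', ← ih]
    congr 2
    exact List.map_congr_left fun j _ => hf j

theorem cyclicLetter_neg {q p x : ℤ} (hp : 0 < p) (hcop : IsCoprime q p) (h : ¬ p ∣ x) :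
    cyclicLetter q p (-x) = flipLetter (cyclicLetter q p x) := by
  apply Prod.ext
  · rw [flipLetter_fst, cyclicLetter_fst_eq_iff]
    omega
  · have h1 : ¬ p ∣ x * q := fun hd => h (hcop.symm.dvd_of_dvd_mul_right hd)
    rw [flipLetter_snd, cyclicLetter_of_not_dvd h, cyclicLetter_of_not_dvd (by rwa [dvd_neg]),
      neg_mul, neg_ediv_of_not_dvd hp h1, ← decide_not, decide_eq_decide]
    omega

theorem mk_cyclicLetter_eq_letterAt_zpow {q p : ℤ} (hp : 0 < p) {i : ℕ} (h : ¬ p ∣ (i : ℤ)) :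
    FreeGroup.mk [cyclicLetter q p i] = letterAt i ^ epsSgn q p i := by
  have h1 : cyclicLetter q p i = (if i % 2 = 1 then 1 else 0, decide ((i : ℤ) * q / p % 2 = 0)) := by
    apply Prod.ext
    · simp only [cyclicLetter]
      split_ifs <;> first | rfl | omega
    · exact cyclicLetter_of_not_dvd h
  have h2 : epsSgn q p i = if (i : ℤ) * q / p % 2 = 0 then 1 else -1 := by
    rw [epsSgn, Int.fdiv_eq_ediv_of_nonneg _ hp.le]
    split_ifs with hc
    · exact Even.neg_one_pow (Int.natAbs_even.2 (Int.even_iff.2 hc))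
    · exact Odd.neg_one_pow (Int.natAbs_odd.2 (Int.not_even_iff_odd.1 (mt Int.even_iff.1 hc)))
  rw [h1, h2, letterAt, ga, gb]
  split_ifs with ha hb hb <;> simp [hb, FreeGroup.of, FreeGroup.inv_mk, FreeGroup.invRev]

theorem uWord_eq_prod_cyclicLetter {q p : ℤ} (hp : 2 ≤ p) (hcop : IsCoprime q p) :
    uWord q p =
      ((List.range (2 * p.toNat)).map (fun j : ℕ => FreeGroup.mk [cyclicLetter q p j])).prod := by
  obtain ⟨k, hk⟩ : ∃ k : ℕ, p = k + 1 := ⟨(p - 1).toNat, by omega⟩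
  have hnd : ∀ j : ℕ, j < k → ¬ p ∣ ((j + 1 : ℕ) : ℤ) := fun j hj hd => by
    have := Int.le_of_dvd (by omega) hd
    omega
  have hw : wWord q p =
      ((List.range k).map (fun j : ℕ => FreeGroup.mk [cyclicLetter q p (j + 1 : ℕ)])).prod := by
    rw [wWord, show p.toNat - 1 = k by omega]
    congr 1
    refine List.map_congr_left fun j hj => ?_
    exact (mk_cyclicLetter_eq_letterAt_zpow (by omega) (hnd j (List.mem_range.1 hj))).symm
  have hinv : (wWord q p)⁻¹ = ((List.range k).map
      (fun j : ℕ => FreeGroup.mk [cyclicLetter q p (k + 1 + (j + 1) : ℕ)])).prod := by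
    rw [hw, inv_prod_map_range]
    congr 1
    refine List.map_congr_left fun j hj => ?_
    have hj' := List.mem_range.1 hj
    rw [← mk_flipLetter, ← cyclicLetter_neg (by omega) hcop (hnd _ (by omega))]
    congr 2
    refine cyclicLetter_congr (by omega) ⟨-1, ?_⟩
    push_cast [Nat.sub_sub, Nat.cast_sub (show 1 + j ≤ k by omega)]
    rw [hk]
    ring
  have h0 : FreeGroup.mk [cyclicLetter q p (0 : ℕ)] = ga := by
    simp [cyclicLetter, ga, FreeGroup.of]
  have h1 : FreeGroup.mk [cyclicLetter q p (k + 1 + 0 : ℕ)] =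
      if p % 2 = 0 then ga⁻¹ else gb⁻¹ := by
    have e : ((k + 1 + 0 : ℕ) : ℤ) = p := by rw [hk]; push_cast; ring
    have e2 : ¬ 2 * p ∣ p := fun hd => by
      have := Int.le_of_dvd (by omega) hd
      omega
    rw [e, ga, gb]
    simp only [cyclicLetter, dvd_refl, if_true, e2]
    split_ifs <;> simp [FreeGroup.of, FreeGroup.inv_mk, FreeGroup.invRev]
  rw [show 2 * p.toNat = (k + 1) + (k + 1) by omega, List.range_add, List.map_append,
    List.prod_append, List.map_map, List.prod_range_succ', List.prod_range_succ']
  simp only [Function.comp, Nat.succ_eq_add_one]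
  rw [h0, h1, ← hw, ← hinv, uWord]
  split_ifs <;> simp only [mul_assoc]

theorem faceProd_faceLetter_true {q p : ℤ} (hp : 2 ≤ p) (hcop : IsCoprime q p) (n : ℕ)
    [NeZero (2 * p.toNat * n)] :
    faceProd (fun j => FreeGroup.mk [faceLetter q p (2 * p.toNat * n) true j]) =
      uWord q p ^ n := by
  rw [uWord_eq_prod_cyclicLetter hp hcop, ← prod_map_range_mul, faceProd]
  · congr 1
    refine List.map_congr_left fun j _ => ?_
    rw [← Int.cast_natCast, faceLetter_true (by omega)]
    refine ⟨n, ?_⟩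
    push_cast
    rw [Int.toNat_of_nonneg (by omega)]
  · intro j
    congr 2
    refine cyclicLetter_congr (by omega) ⟨1, ?_⟩
    push_cast
    rw [Int.toNat_of_nonneg (by omega)]
    ring

theorem faceProd_faceLetter_false {q p : ℤ} (hp : 0 < p) {m : ℕ} [NeZero m] (hm : 2 * p ∣ m) :
    faceProd (fun j => FreeGroup.mk [faceLetter q p m false j]) =
      (faceProd (fun j => FreeGroup.mk [faceLetter q p m true j]))⁻¹ := by
  rw [faceProd, faceProd, inv_prod_map_range]
  congr 1
  refine List.map_congr_left fun j hj => ?_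
  have hj' := List.mem_range.1 hj
  rw [← mk_flipLetter, ← Int.cast_natCast, ← Int.cast_natCast (m - 1 - j),
    faceLetter_false hp hm, faceLetter_true hp hm]
  congr 3
  refine cyclicLetter_congr hp ?_
  have : -1 - (j : ℤ) - ((m - 1 - j : ℕ) : ℤ) = -m := by omega
  rw [this]
  exact hm.neg_right

theorem not_injective_heckoid {q p : ℤ} (hp : 2 ≤ p) (hcop : IsCoprime q p) {n : ℕ} (hn : 2 ≤ n)
    (f : Multiplicative ℤ × Multiplicative ℤ →* F2 ⧸ heckoidRel q p n) :
    ¬ Function.Injective f := by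
  have hm0 : 4 * (p.toNat - 1) < 2 * p.toNat * n := by
    have : 2 * p.toNat * 2 ≤ 2 * p.toNat * n := Nat.mul_le_mul_left _ hn
    omega
  have : NeZero (2 * p.toNat * n) := ⟨by omega⟩
  have hm : 2 * p ∣ ((2 * p.toNat * n : ℕ) : ℤ) := by
    refine ⟨n, ?_⟩
    push_cast
    rw [Int.toNat_of_nonneg (by omega)]
  set π := QuotientGroup.mk' (heckoidRel q p n) with hπ
  set R := faceLetter q p (2 * p.toNat * n) with hR
  set w : Bool → F2 := fun s => faceProd (fun j => FreeGroup.mk [R s j]) with hw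
  have hw1 : w true = uWord q p ^ n := faceProd_faceLetter_true hp hcop n
  have hw2 : w false = (w true)⁻¹ := faceProd_faceLetter_false (by omega) hm
  have hmem : uWord q p ^ n ∈ heckoidRel q p n := Subgroup.subset_normalClosure rfl
  have hq : ∀ s, π (w s) = 1 := by
    intro s
    cases s
    · rw [hw2, map_inv, inv_eq_one, hw1]
      exact (QuotientGroup.eq_one_iff _).2 hmem
    · rw [hw1]
      exact (QuotientGroup.eq_one_iff _).2 hmem
  obtain ⟨X, hX⟩ := QuotientGroup.mk'_surjective (heckoidRel q p n) (f (Multiplicative.ofAdd 1, 1))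
  obtain ⟨Y, hY⟩ := QuotientGroup.mk'_surjective (heckoidRel q p n) (f (1, Multiplicative.ofAdd 1))
  have hker : (X * Y * X⁻¹ * Y⁻¹)⁻¹ ∈ Subgroup.normalClosure {w true} := by
    rw [hw1]
    refine inv_mem ((QuotientGroup.eq_one_iff (N := heckoidRel q p n) _).1 ?_)
    change π (X * Y * X⁻¹ * Y⁻¹) = 1
    rw [map_mul, map_mul, map_mul, map_inv, map_inv, hX, hY, ← map_mul, ← map_inv, ← map_mul,
      ← map_inv, ← map_mul, ← map_one f]
    congr 1
  obtain ⟨L, hL⟩ := exists_list_of_mem_normalClosure w hw2 hker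
  obtain ⟨X', Y', hX', hY', hcomm⟩ := exists_commuting_lifts hm0 R π hq
    (faceLetter_add_one_fst_ne (by omega) hm) (faceLetter_mirror hp hcop hm) L X Y (by
      rw [listTorusProd]
      exact (congrArg (X * Y * X⁻¹ * Y⁻¹ * ·) hL).trans (mul_inv_cancel _))
  obtain ⟨i, j, hij, h⟩ := FreeGroup.exists_zpow_eq_of_commute hcomm
  refine not_injective_of_zpow_eq f hij ?_
  rw [← hX, ← hY, ← hX', ← hY', ← map_zpow, ← map_zpow, h]

theorem not_exists_abelian_of_zpow_independent {G : Type*} [Group G]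
    (hG : ∀ f : Multiplicative ℤ × Multiplicative ℤ →* G, ¬ Function.Injective f) {x y : G}
    (h : ∀ i j : ℤ, x ^ i * y ^ j = 1 → i = 0 ∧ j = 0) :
    ¬ ∃ K : Subgroup G, K.index ≠ 0 ∧ ∀ a b : K, a * b = b * a := by
  rintro ⟨K, hK, hcomm⟩
  obtain ⟨k, hk, -, hxk⟩ := Subgroup.exists_pow_mem_of_index_ne_zero hK x
  obtain ⟨l, hl, -, hyl⟩ := Subgroup.exists_pow_mem_of_index_ne_zero hK y
  have hxy : Commute (x ^ k) (y ^ l) := congrArg Subtype.val (hcomm ⟨_, hxk⟩ ⟨_, hyl⟩)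
  have hcomm' : ∀ i j : Multiplicative ℤ,
      Commute (zpowersHom G (x ^ k) i) (zpowersHom G (y ^ l) j) := fun i j => hxy.zpow_zpow _ _
  refine hG (MonoidHom.noncommCoprod (zpowersHom G (x ^ k)) (zpowersHom G (y ^ l)) hcomm') ((injective_iff_map_eq_one _).2 ?_)
  rintro ⟨i, j⟩ hij
  rw [MonoidHom.noncommCoprod_apply, zpowersHom_apply, zpowersHom_apply, ← zpow_natCast,
    ← zpow_natCast, ← zpow_mul, ← zpow_mul] at hij
  obtain ⟨hi, hj⟩ := h _ _ hij
  have hia : i.toAdd = 0 := (mul_eq_zero.1 hi).resolve_left (by omega)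
  have hja : j.toAdd = 0 := (mul_eq_zero.1 hj).resolve_left (by omega)
  exact Prod.ext (toAdd_eq_zero.1 hia) (toAdd_eq_zero.1 hja)

/-- `σ` acts on `ZMod n × ℤ` over the translation by `e`, with total displacement `s`. -/
def IsShift {n : ℕ} [NeZero n] (σ : Equiv.Perm (ZMod n × ℤ)) (e : ZMod n) (s : ℤ) : Prop :=
  ∃ g : ZMod n → ℤ, (∀ i m, σ (i, m) = (i + e, m + g i)) ∧ ∑ i, g i = s

namespace IsShift

variable {n : ℕ} [NeZero n] {σ τ : Equiv.Perm (ZMod n × ℤ)} {e e' : ZMod n} {s s' : ℤ}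

theorem one : IsShift (1 : Equiv.Perm (ZMod n × ℤ)) 0 0 := ⟨0, by simp⟩

theorem mul (h : IsShift σ e s) (h' : IsShift τ e' s') : IsShift (σ * τ) (e + e') (s + s') := by
  obtain ⟨g, hg, rfl⟩ := h
  obtain ⟨g', hg', rfl⟩ := h'
  refine ⟨fun i => g' i + g (i + e'), fun i m => ?_, ?_⟩
  · rw [Equiv.Perm.mul_apply, hg', hg]
    ext <;> simp only <;> ring
  · rw [Finset.sum_add_distrib, add_comm]
    exact congrArg (· + _) (Equiv.sum_comp (Equiv.addRight e') g)

theorem inv (h : IsShift σ e s) : IsShift σ⁻¹ (-e) (-s) := by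
  obtain ⟨g, hg, rfl⟩ := h
  refine ⟨fun i => -g (i + -e), fun i m => ?_, ?_⟩
  · rw [Equiv.Perm.inv_eq_iff_eq, hg]
    ext <;> simp only <;> ring
  · rw [Finset.sum_neg_distrib]
    exact congrArg (-·) (Equiv.sum_comp (Equiv.addRight (-e)) g)

theorem pow_eq_one (h : IsShift σ 1 0) : σ ^ n = 1 := by
  obtain ⟨g, hg, hs⟩ := h
  have key : ∀ (k : ℕ) i m, (σ ^ k) (i, m) = (i + k, m + ∑ j ∈ Finset.range k, g (i + j)) := by
    intro k i m
    induction k with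
    | zero => simp
    | succ k ih =>
      rw [pow_succ', Equiv.Perm.mul_apply, ih, hg, Finset.sum_range_succ]
      ext <;> push_cast <;> ring
  have hsum : ∀ i, ∑ j ∈ Finset.range n, g (i + (j : ZMod n)) = 0 := by
    intro i
    rw [← hs, ← Equiv.sum_comp (Equiv.addLeft i) g]
    exact Finset.sum_nbij' (fun j => (j : ZMod n)) ZMod.val (by simp)
      (fun j _ => Finset.mem_range.2 (ZMod.val_lt j))
      (fun j hj => ZMod.val_cast_of_lt (Finset.mem_range.1 hj)) (by simp) (by simp)
  ext1 ⟨i, m⟩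
  rw [key, hsum]
  simp

end IsShift

section Shift

variable (n : ℕ)

/-- The shear of `ZMod n × ℤ` supported on the fibre over `0`. -/
def shearPerm : Equiv.Perm (ZMod n × ℤ) where
  toFun x := (x.1, x.2 + if x.1 = 0 then 1 else 0)
  invFun x := (x.1, x.2 - if x.1 = 0 then 1 else 0)
  left_inv x := by simp
  right_inv x := by simp

/-- The rotation of `ZMod n × ℤ` by `1` in the first coordinate. -/
def rotatePerm : Equiv.Perm (ZMod n × ℤ) := (Equiv.addRight 1).prodCongr (Equiv.refl ℤ)

/-- The action of `F` on `ZMod n × ℤ`. -/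
def shiftHom : F2 →* Equiv.Perm (ZMod n × ℤ) :=
  FreeGroup.lift ![rotatePerm n * shearPerm n, shearPerm n]

variable {n}

theorem shearPerm_apply (i : ZMod n) (m : ℤ) :
    shearPerm n (i, m) = (i, m + if i = 0 then 1 else 0) := rfl

theorem shearPerm_zpow_apply (k : ℤ) (i : ZMod n) (m : ℤ) :
    (shearPerm n ^ k) (i, m) = (i, m + if i = 0 then k else 0) := by
  induction k generalizing m with
  | zero => simp
  | succ k ih =>
    rw [zpow_add_one, Equiv.Perm.mul_apply, shearPerm_apply, ih]
    ext <;> simp only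
    split_ifs <;> ring
  | pred k ih =>
    have : (shearPerm n)⁻¹ (i, m) = (i, m - if i = 0 then 1 else 0) := rfl
    rw [zpow_sub_one, Equiv.Perm.mul_apply, this, ih]
    ext <;> simp only
    split_ifs <;> ring

theorem rotatePerm_apply (i : ZMod n) (m : ℤ) : rotatePerm n (i, m) = (i + 1, m) := rfl

theorem rotatePerm_inv_apply (i : ZMod n) (m : ℤ) : (rotatePerm n)⁻¹ (i, m) = (i - 1, m) := by
  rw [Equiv.Perm.inv_eq_iff_eq, rotatePerm_apply, sub_add_cancel]

theorem isShift_shearPerm [NeZero n] : IsShift (shearPerm n) 0 1 :=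
  ⟨fun i => if i = 0 then 1 else 0, fun i m => by rw [shearPerm_apply, add_zero], by simp⟩

theorem isShift_rotatePerm [NeZero n] : IsShift (rotatePerm n) 1 0 :=
  ⟨0, fun i m => by simp [rotatePerm_apply], by simp⟩

theorem shiftHom_ga : shiftHom n ga = rotatePerm n * shearPerm n := by
  simp [shiftHom, ga]

theorem shiftHom_gb : shiftHom n gb = shearPerm n := by
  simp [shiftHom, gb]

theorem exists_isShift_shiftHom [NeZero n] (w : F2) : ∃ e s, IsShift (shiftHom n w) e s := by
  induction w using FreeGroup.induction_on with
  | C1 => exact ⟨0, 0, by rw [map_one]; exact IsShift.one⟩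
  | of i =>
    fin_cases i
    · exact ⟨_, _, shiftHom_ga (n := n) ▸ isShift_rotatePerm.mul isShift_shearPerm⟩
    · exact ⟨_, _, shiftHom_gb (n := n) ▸ isShift_shearPerm⟩
  | inv_of i h =>
    obtain ⟨e, s, h⟩ := h
    exact ⟨_, _, by rw [map_inv]; exact h.inv⟩
  | mul x y hx hy =>
    obtain ⟨e, s, h⟩ := hx
    obtain ⟨e', s', h'⟩ := hy
    exact ⟨_, _, by rw [map_mul]; exact h.mul h'⟩

theorem shiftHom_conj_pow_eq_one [NeZero n] (w : F2) :
    shiftHom n (ga * w * gb⁻¹ * w⁻¹) ^ n = 1 := by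
  obtain ⟨e, s, h⟩ := exists_isShift_shiftHom (n := n) w
  rw [map_mul, map_mul, map_mul, map_inv, map_inv, shiftHom_ga, shiftHom_gb]
  have := (((isShift_rotatePerm.mul isShift_shearPerm).mul h).mul
    isShift_shearPerm.inv).mul h.inv
  apply IsShift.pow_eq_one
  convert this using 1 <;> ring

end Shift

theorem exists_zpow_independent (q p : ℤ) {n : ℕ} (hn : 2 ≤ n) :
    ∃ x y : F2 ⧸ heckoidRel q p n, ∀ i j : ℤ, x ^ i * y ^ j = 1 → i = 0 ∧ j = 0 := by
  have key : ∀ {B : Type} [Group B] (ψ : F2 →* B), ψ (uWord q p ^ n) = 1 → ∀ x y : F2,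
      (∀ i j : ℤ, ψ x ^ i * ψ y ^ j = 1 → i = 0 ∧ j = 0) →
      ∃ x y : F2 ⧸ heckoidRel q p n, ∀ i j : ℤ, x ^ i * y ^ j = 1 → i = 0 ∧ j = 0 := by
    intro B _ ψ hψ x y h
    have hle : ∀ g ∈ heckoidRel q p n, ψ g = 1 := fun g hg =>
      Subgroup.normalClosure_le_normal (N := ψ.ker) (by simpa using hψ) hg
    refine ⟨(x : F2 ⧸ heckoidRel q p n), (y : F2 ⧸ heckoidRel q p n), fun i j hij => h i j ?_⟩
    have := congrArg (QuotientGroup.lift (heckoidRel q p n) ψ hle) hij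
    rw [map_mul, map_zpow, map_zpow, map_one] at this
    exact this
  rcases Int.emod_two_eq_zero_or_one p with hp | hp
  · refine key (FreeGroup.lift ![(Multiplicative.ofAdd (1 : ℤ), (1 : Multiplicative ℤ)),
      (1, Multiplicative.ofAdd 1)]) ?_ ga gb ?_
    · rw [uWord, if_pos hp, map_pow]
      simp only [map_mul, map_inv]
      rw [mul_right_comm, mul_inv_cancel_right, mul_inv_cancel, one_pow]
    · intro i j hij
      simp only [ga, gb, FreeGroup.lift_apply_of] at hij
      have h1 := congrArg (fun z => Multiplicative.toAdd z.1) hij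
      have h2 := congrArg (fun z => Multiplicative.toAdd z.2) hij
      simp at h1 h2
      exact ⟨h1, h2⟩
  · have : NeZero n := ⟨by omega⟩
    have : Fact (1 < n) := ⟨hn⟩
    refine key (shiftHom n) ?_ gb (ga * gb * ga⁻¹) ?_
    · rw [uWord, if_neg (by omega), map_pow]
      exact shiftHom_conj_pow_eq_one _
    · intro i j hij
      have hconj : shiftHom n (ga * gb * ga⁻¹) =
          rotatePerm n * shearPerm n * (rotatePerm n)⁻¹ := by
        rw [map_mul, map_mul, map_inv, shiftHom_ga, shiftHom_gb]
        group
      rw [hconj, shiftHom_gb, conj_zpow] at hij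
      have h0 := congrArg Prod.snd (Equiv.congr_fun hij (0, 0))
      have h1 := congrArg Prod.snd (Equiv.congr_fun hij (1, 0))
      simp only [Equiv.Perm.mul_apply, Equiv.Perm.one_apply, rotatePerm_inv_apply,
        rotatePerm_apply, shearPerm_zpow_apply] at h0 h1
      simp at h0 h1
      exact ⟨h0, h1⟩

/-- Let `r = q/p` with `0 < r < 1`, `gcd(q,p) = 1`, and `n ≥ 2`
an integer.  The even Heckoid group `H(r;n) = F/⟨⟨u_r^n⟩⟩` contains no subgroup
isomorphic to `ℤ × ℤ` (no injective homomorphism from `ℤ × ℤ`), and it is not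
virtually abelian (it has no abelian subgroup of finite index). -/
theorem stmt8 (q p : ℤ) (hp : 1 ≤ p) (hcop : Int.gcd q p = 1)
    (h0 : 0 < (q : ℚ) / p) (h1 : (q : ℚ) / p < 1)
    (n : ℕ) (hn : 2 ≤ n) :
    (∀ f : (Multiplicative ℤ × Multiplicative ℤ) →* (F2 ⧸ heckoidRel q p n),
      ¬ Function.Injective f) ∧
    ¬ ∃ K : Subgroup (F2 ⧸ heckoidRel q p n), K.index ≠ 0 ∧ ∀ a b : K, a * b = b * a := by
  have hpq : (0 : ℚ) < p := by exact_mod_cast hp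
  have hq0 : 0 < q := by exact_mod_cast (div_pos_iff_of_pos_right hpq).1 h0
  have hqp : q < p := by exact_mod_cast (div_lt_one hpq).1 h1
  have hZ : ∀ f : Multiplicative ℤ × Multiplicative ℤ →* F2 ⧸ heckoidRel q p n,
      ¬ Function.Injective f :=
    not_injective_heckoid (by omega) (Int.isCoprime_iff_gcd_eq_one.2 hcop) hn
  obtain ⟨x, y, hxy⟩ := exists_zpow_independent q p hn
  exact ⟨hZ, not_exists_abelian_of_zpow_independent hZ hxy⟩
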